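/- Let T be a locally satisfiable negative local theory that is local positively compact. Then every |L|⁺-ultrahomogeneous local positively closed model of T is a retractor of T. In particular, T has retractors. -/

import Mathlib

noncomputable section

structure LocalLanguage : Type 1 where
  Sorts : Type
  Rel : (n : ℕ) → (Fin n → Sorts) → Type
  Const : Sorts → Type
  Loc : Sorts → Type
  locToRel : {s : Sorts} → Loc s → Rel 2 ![s, s]
  dd0 : (s : Sorts) → Loc s
  locMul : {s : Sorts} → Loc s → Loc s → Loc s
  locLe : {s : Sorts} → Loc s → Loc s → Prop
  locMul_assoc : ∀ {s} (d₁ d₂ d₃ : Loc s), locMul (locMul d₁ d₂) d₃ = locMul d₁ (locMul d₂ d₃)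
  dd0_locMul : ∀ {s} (d : Loc s), locMul (dd0 s) d = d
  locMul_dd0 : ∀ {s} (d : Loc s), locMul d (dd0 s) = d
  locLe_refl : ∀ {s} (d : Loc s), locLe d d
  locLe_trans : ∀ {s} (d₁ d₂ d₃ : Loc s), locLe d₁ d₂ → locLe d₂ d₃ → locLe d₁ d₃
  locLe_antisymm : ∀ {s} (d₁ d₂ : Loc s), locLe d₁ d₂ → locLe d₂ d₁ → d₁ = d₂
  dd0_locLe : ∀ {s} (d : Loc s), locLe (dd0 s) d
  locMul_mono : ∀ {s} (d₁ d₂ e₁ e₂ : Loc s), locLe d₁ e₁ → locLe d₂ e₂ →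
    locLe (locMul d₁ d₂) (locMul e₁ e₂)
  bound : {s : Sorts} → Const s → Const s → Loc s

structure LStructure (L : LocalLanguage) : Type 1 where
  Dom : L.Sorts → Type
  relMap : {n : ℕ} → {ρ : Fin n → L.Sorts} → L.Rel n ρ → ((i : Fin n) → Dom (ρ i)) → Prop
  constMap : {s : L.Sorts} → L.Const s → Dom s

def dpair {C : Fin 2 → Sort*} (a : C 0) (b : C 1) : (i : Fin 2) → C i
  | ⟨0, _⟩ => a
  | ⟨1, _⟩ => b

def LStructure.locRel {L : LocalLanguage} (M : LStructure L) {s : L.Sorts}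
    (d : L.Loc s) (a b : M.Dom s) : Prop :=
  M.relMap (L.locToRel d) (dpair a b)

structure IsLocal {L : LocalLanguage} (M : LStructure L) : Prop where
  symm : ∀ {s : L.Sorts} (d : L.Loc s) (a b : M.Dom s), M.locRel d a b → M.locRel d b a
  mono : ∀ {s : L.Sorts} (d₁ d₂ : L.Loc s), L.locLe d₁ d₂ →
    ∀ (a b : M.Dom s), M.locRel d₁ a b → M.locRel d₂ a b
  comp : ∀ {s : L.Sorts} (d₁ d₂ : L.Loc s) (a b c : M.Dom s),
    M.locRel d₁ a b → M.locRel d₂ b c → M.locRel (L.locMul d₁ d₂) a c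
  boundAx : ∀ {s : L.Sorts} (c₁ c₂ : L.Const s),
    M.locRel (L.bound c₁ c₂) (M.constMap c₁) (M.constMap c₂)
  total : ∀ {s : L.Sorts} (a b : M.Dom s), ∃ d : L.Loc s, M.locRel d a b
  dd0_eq : ∀ {s : L.Sorts} (a b : M.Dom s), M.locRel (L.dd0 s) a b ↔ a = b

/-! ## Syntax -/

/-- Terms: variables or constants (the language is relational). -/
inductive LTerm (L : LocalLanguage) (α : Type) (σ : α → L.Sorts) : L.Sorts → Type
  | var (a : α) : LTerm L α σ (σ a)
  | const {s : L.Sorts} (c : L.Const s) : LTerm L α σ s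

/-- Sort assignment for a context extended by one variable of sort `s`. -/
abbrev osort {L : LocalLanguage} {α : Type} (s : L.Sorts) (σ : α → L.Sorts) :
    Option α → L.Sorts :=
  fun o => Option.elim o s σ

/-- Positive formulas: atomic, conjunction, disjunction, existential quantification. -/
inductive PosForm (L : LocalLanguage) : (α : Type) → (α → L.Sorts) → Type 1
  | rel {α : Type} {σ : α → L.Sorts} {n : ℕ} {ρ : Fin n → L.Sorts}
      (R : L.Rel n ρ) (ts : (i : Fin n) → LTerm L α σ (ρ i)) : PosForm L α σ
  | and {α : Type} {σ : α → L.Sorts} (φ ψ : PosForm L α σ) : PosForm L α σ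
  | or {α : Type} {σ : α → L.Sorts} (φ ψ : PosForm L α σ) : PosForm L α σ
  | ex {α : Type} {σ : α → L.Sorts} (s : L.Sorts)
      (φ : PosForm L (Option α) (osort s σ)) : PosForm L α σ

/-- Local positive formulas: atomic, conjunction, disjunction, local existential
quantification `∃ x ∈ d(t) φ`. -/
inductive LPosForm (L : LocalLanguage) : (α : Type) → (α → L.Sorts) → Type 1
  | rel {α : Type} {σ : α → L.Sorts} {n : ℕ} {ρ : Fin n → L.Sorts}
      (R : L.Rel n ρ) (ts : (i : Fin n) → LTerm L α σ (ρ i)) : LPosForm L α σ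
  | and {α : Type} {σ : α → L.Sorts} (φ ψ : LPosForm L α σ) : LPosForm L α σ
  | or {α : Type} {σ : α → L.Sorts} (φ ψ : LPosForm L α σ) : LPosForm L α σ
  | lex {α : Type} {σ : α → L.Sorts} (s : L.Sorts) (d : L.Loc s) (t : LTerm L α σ s)
      (φ : LPosForm L (Option α) (osort s σ)) : LPosForm L α σ

/-- Local formulas: atomic, negation, conjunction, local existential quantification. -/
inductive LForm (L : LocalLanguage) : (α : Type) → (α → L.Sorts) → Type 1
  | rel {α : Type} {σ : α → L.Sorts} {n : ℕ} {ρ : Fin n → L.Sorts}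
      (R : L.Rel n ρ) (ts : (i : Fin n) → LTerm L α σ (ρ i)) : LForm L α σ
  | not {α : Type} {σ : α → L.Sorts} (φ : LForm L α σ) : LForm L α σ
  | and {α : Type} {σ : α → L.Sorts} (φ ψ : LForm L α σ) : LForm L α σ
  | lex {α : Type} {σ : α → L.Sorts} (s : L.Sorts) (d : L.Loc s) (t : LTerm L α σ s)
      (φ : LForm L (Option α) (osort s σ)) : LForm L α σ

/-! ## Semantics -/

def LTerm.realize {L : LocalLanguage} (M : LStructure L) {α : Type} {σ : α → L.Sorts}
    (v : (a : α) → M.Dom (σ a)) : {s : L.Sorts} → LTerm L α σ s → M.Dom s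
  | _, .var a => v a
  | _, .const c => M.constMap c

/-- Extension of a valuation by a value for the new variable. -/
def vcons {L : LocalLanguage} {M : LStructure L} {α : Type} {σ : α → L.Sorts} {s : L.Sorts}
    (x : M.Dom s) (v : (a : α) → M.Dom (σ a)) : (o : Option α) → M.Dom (osort s σ o)
  | none => x
  | some a => v a

def PosForm.Realize {L : LocalLanguage} (M : LStructure L) :
    {α : Type} → {σ : α → L.Sorts} → PosForm L α σ → ((a : α) → M.Dom (σ a)) → Prop
  | _, _, .rel R ts, v => M.relMap R (fun i => (ts i).realize M v)
  | _, _, .and φ ψ, v => φ.Realize M v ∧ ψ.Realize M v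
  | _, _, .or φ ψ, v => φ.Realize M v ∨ ψ.Realize M v
  | _, _, .ex s φ, v => ∃ x : M.Dom s, φ.Realize M (vcons x v)

def LPosForm.Realize {L : LocalLanguage} (M : LStructure L) :
    {α : Type} → {σ : α → L.Sorts} → LPosForm L α σ → ((a : α) → M.Dom (σ a)) → Prop
  | _, _, .rel R ts, v => M.relMap R (fun i => (ts i).realize M v)
  | _, _, .and φ ψ, v => φ.Realize M v ∧ ψ.Realize M v
  | _, _, .or φ ψ, v => φ.Realize M v ∨ ψ.Realize M v
  | _, _, .lex s d t φ, v =>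
      ∃ x : M.Dom s, M.locRel d x (t.realize M v) ∧ φ.Realize M (vcons x v)

def LForm.Realize {L : LocalLanguage} (M : LStructure L) :
    {α : Type} → {σ : α → L.Sorts} → LForm L α σ → ((a : α) → M.Dom (σ a)) → Prop
  | _, _, .rel R ts, v => M.relMap R (fun i => (ts i).realize M v)
  | _, _, .not φ, v => ¬ φ.Realize M v
  | _, _, .and φ ψ, v => φ.Realize M v ∧ ψ.Realize M v
  | _, _, .lex s d t φ, v =>
      ∃ x : M.Dom s, M.locRel d x (t.realize M v) ∧ φ.Realize M (vcons x v)

/-- Quantifier-free positive formulas. -/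
inductive PosForm.IsQF {L : LocalLanguage} : {α : Type} → {σ : α → L.Sorts} → PosForm L α σ → Prop
  | rel {α : Type} {σ : α → L.Sorts} {n : ℕ} {ρ : Fin n → L.Sorts}
      (R : L.Rel n ρ) (ts : (i : Fin n) → LTerm L α σ (ρ i)) : PosForm.IsQF (.rel R ts)
  | and {α : Type} {σ : α → L.Sorts} {φ ψ : PosForm L α σ} :
      PosForm.IsQF φ → PosForm.IsQF ψ → PosForm.IsQF (.and φ ψ)
  | or {α : Type} {σ : α → L.Sorts} {φ ψ : PosForm L α σ} :
      PosForm.IsQF φ → PosForm.IsQF ψ → PosForm.IsQF (.or φ ψ)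


/-! ## Sentences, theories, models -/

/-- Sort assignment for the empty context. -/
abbrev emptySorts (L : LocalLanguage) : Empty → L.Sorts := fun e => e.elim

/-- Positive sentences. -/
abbrev PosSentence (L : LocalLanguage) := PosForm L Empty (emptySorts L)

/-- A positive sentence holds in a structure. -/
def PosSentence.RealizedIn {L : LocalLanguage} (φ : PosSentence L) (M : LStructure L) : Prop :=
  φ.Realize M (fun e => e.elim)

/-- We represent a negative theory by the set of positive sentences whose negations
belong to it.  `M` is a local model of `T` if `M` is local and satisfies the negation of
every positive sentence in `T`. -/
def LocalModel {L : LocalLanguage} (M : LStructure L) (T : Set (PosSentence L)) : Prop :=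
  IsLocal M ∧ ∀ φ ∈ T, ¬ φ.RealizedIn M

/-- `T` (a set of positive sentences standing for the negative theory `{¬φ : φ ∈ T}`)
is a negative local theory if it is closed under local implication: any negative sentence
true in every local model of `T` is already in `T`. -/
def IsNegLocalTheory {L : LocalLanguage} (T : Set (PosSentence L)) : Prop :=
  ∀ φ : PosSentence L, (∀ M : LStructure L, LocalModel M T → ¬ φ.RealizedIn M) → φ ∈ T

/-- `T` is locally satisfiable: it has a local model. -/
def LocSat {L : LocalLanguage} (T : Set (PosSentence L)) : Prop :=
  ∃ M : LStructure L, LocalModel M T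

/-- The negative theory of a structure (as the set of positive sentences failing in it). -/
def ThNeg {L : LocalLanguage} (M : LStructure L) : Set (PosSentence L) :=
  {φ | ¬ φ.RealizedIn M}

/-! ## Homomorphisms -/

structure LHom {L : LocalLanguage} (M N : LStructure L) where
  toFun : (s : L.Sorts) → M.Dom s → N.Dom s
  map_rel : ∀ {n : ℕ} {ρ : Fin n → L.Sorts} (R : L.Rel n ρ) (x : (i : Fin n) → M.Dom (ρ i)),
    M.relMap R x → N.relMap R (fun i => toFun (ρ i) (x i))
  map_const : ∀ {s : L.Sorts} (c : L.Const s), toFun s (M.constMap c) = N.constMap c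

def LHom.comp {L : LocalLanguage} {M N P : LStructure L} (g : LHom N P) (f : LHom M N) :
    LHom M P where
  toFun s := g.toFun s ∘ f.toFun s
  map_rel R x h := g.map_rel R _ (f.map_rel R x h)
  map_const c := by
    simp only [Function.comp_apply, f.map_const, g.map_const]

def LHom.id {L : LocalLanguage} (M : LStructure L) : LHom M M where
  toFun _ := fun x => x
  map_rel _ _ h := h
  map_const _ := rfl

/-- A homomorphism is a positive embedding if it reflects all positive formulas. -/
def LHom.IsPosEmbedding {L : LocalLanguage} {M N : LStructure L} (h : LHom M N) : Prop :=
  ∀ (α : Type) (σ : α → L.Sorts) (φ : PosForm L α σ) (v : (a : α) → M.Dom (σ a)),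
    φ.Realize N (fun a => h.toFun (σ a) (v a)) → φ.Realize M v

/-- A local positively closed model of `T`. -/
def IsPC {L : LocalLanguage} (M : LStructure L) (T : Set (PosSentence L)) : Prop :=
  LocalModel M T ∧
    ∀ (N : LStructure L) (h : LHom M N), LocalModel N T → h.IsPosEmbedding

/-- An endomorphism is an automorphism if it has a two-sided inverse homomorphism. -/
def LHom.IsAuto {L : LocalLanguage} {M : LStructure L} (f : LHom M M) : Prop :=
  ∃ g : LHom M M, g.comp f = LHom.id M ∧ f.comp g = LHom.id M

/-- Isomorphism of structures. -/
def Isomorphic {L : LocalLanguage} (M N : LStructure L) : Prop :=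
  ∃ (f : LHom M N) (g : LHom N M), g.comp f = LHom.id M ∧ f.comp g = LHom.id N

/-! ## Types -/

/-- The local positive type of a tuple. -/
def ltp {L : LocalLanguage} (M : LStructure L) {α : Type} {σ : α → L.Sorts}
    (v : (a : α) → M.Dom (σ a)) : Set (LPosForm L α σ) :=
  {φ | φ.Realize M v}

/-- The positive type of a tuple. -/
def ptp {L : LocalLanguage} (M : LStructure L) {α : Type} {σ : α → L.Sorts}
    (v : (a : α) → M.Dom (σ a)) : Set (PosForm L α σ) :=
  {φ | φ.Realize M v}

/-- A partial local positive type of `T` on `(α, σ)`: a set of local positive formulas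
realized by some tuple in some local model of `T`. -/
def IsPartialLType {L : LocalLanguage} (T : Set (PosSentence L)) {α : Type}
    {σ : α → L.Sorts} (Γ : Set (LPosForm L α σ)) : Prop :=
  ∃ (M : LStructure L) (v : (a : α) → M.Dom (σ a)),
    LocalModel M T ∧ ∀ φ ∈ Γ, LPosForm.Realize M φ v

/-- A local positive type: a maximal partial local positive type. -/
def IsLType {L : LocalLanguage} (T : Set (PosSentence L)) {α : Type}
    {σ : α → L.Sorts} (Γ : Set (LPosForm L α σ)) : Prop :=
  IsPartialLType T Γ ∧ ∀ Γ' : Set (LPosForm L α σ), IsPartialLType T Γ' → Γ ⊆ Γ' → Γ' = Γ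

/-- A variable `(α, σ)` is pointed if every sort not occurring among its sorts carries a
constant symbol. -/
def VPointed {L : LocalLanguage} {α : Type} (σ : α → L.Sorts) : Prop :=
  ∀ s : L.Sorts, s ∉ Set.range σ → Nonempty (L.Const s)


/-! ## Bounds and bounded satisfiability -/

/-- Pair of terms as arguments for a binary relation symbol. -/
def tpair {L : LocalLanguage} {α : Type} {σ : α → L.Sorts} {s t : L.Sorts}
    (t₁ : LTerm L α σ s) (t₂ : LTerm L α σ t) : (i : Fin 2) → LTerm L α σ (![s, t] i) :=
  dpair t₁ t₂

/-- A bound of the variable `(α, σ)`: a choice, for every single variable whose sort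
carries a constant symbol, of a locality relation and a constant, and for every pair of
single variables of the same sort, of a locality relation. -/
structure VBound (L : LocalLanguage) (α : Type) (σ : α → L.Sorts) where
  dConst : (a : α) → Nonempty (L.Const (σ a)) → L.Loc (σ a)
  cConst : (a : α) → Nonempty (L.Const (σ a)) → L.Const (σ a)
  dPair : (a b : α) → σ a = σ b → L.Loc (σ a)

/-- The set of (atomic, quantifier-free) local positive formulas making up a bound:
`d_a(x_a, c_a)` and `d_{a,b}(x_a, x_b)`. -/
def VBound.toSet {L : LocalLanguage} {α : Type} {σ : α → L.Sorts} (B : VBound L α σ) :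
    Set (LPosForm L α σ) :=
  {φ | (∃ (a : α) (h : Nonempty (L.Const (σ a))),
          φ = LPosForm.rel (L.locToRel (B.dConst a h))
                (tpair (LTerm.var a) (LTerm.const (B.cConst a h)))) ∨
       (∃ (a b : α) (e : σ a = σ b),
          φ = LPosForm.rel (L.locToRel (B.dPair a b e))
                (tpair (LTerm.var a) (e.symm ▸ LTerm.var b)))}

/-- A bound holds of a tuple if all its formulas do. -/
def VBound.Holds {L : LocalLanguage} {α : Type} {σ : α → L.Sorts} (B : VBound L α σ)
    (M : LStructure L) (v : (a : α) → M.Dom (σ a)) : Prop :=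
  ∀ ψ ∈ B.toSet, LPosForm.Realize M ψ v

/-- Finite local satisfiability of a set of local positive formulas in `T`. -/
def FinLocSat {L : LocalLanguage} (T : Set (PosSentence L)) {α : Type} {σ : α → L.Sorts}
    (Δ : Set (LPosForm L α σ)) : Prop :=
  ∀ Δ₀ ⊆ Δ, Δ₀.Finite →
    ∃ (M : LStructure L) (v : (a : α) → M.Dom (σ a)),
      LocalModel M T ∧ ∀ φ ∈ Δ₀, LPosForm.Realize M φ v

/-- Bounded satisfiability: for some bound `B`, `Γ ∪ B` is finitely locally satisfiable. -/
def BoundedlySat {L : LocalLanguage} (T : Set (PosSentence L)) {α : Type}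
    {σ : α → L.Sorts} (Γ : Set (LPosForm L α σ)) : Prop :=
  ∃ B : VBound L α σ, FinLocSat T (Γ ∪ B.toSet)

/-! ## Π₁-local formulas -/

/-- Dependent `Sum.elim` of valuations. -/
def sval {L : LocalLanguage} {M : LStructure L} {α β : Type} {σ : α → L.Sorts}
    {τ : β → L.Sorts} (v : (a : α) → M.Dom (σ a)) (w : (b : β) → M.Dom (τ b)) :
    (x : α ⊕ β) → M.Dom (Sum.elim σ τ x)
  | .inl a => v a
  | .inr b => w b

/-- A Π₁-local formula: a universally quantified local formula. -/
structure Pi1LForm (L : LocalLanguage) (α : Type) (σ : α → L.Sorts) : Type 1 where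
  n : ℕ
  τ : Fin n → L.Sorts
  matrix : LForm L (α ⊕ Fin n) (Sum.elim σ τ)

def Pi1LForm.Realize {L : LocalLanguage} {α : Type} {σ : α → L.Sorts}
    (φ : Pi1LForm L α σ) (M : LStructure L) (v : (a : α) → M.Dom (σ a)) : Prop :=
  ∀ w : (i : Fin φ.n) → M.Dom (φ.τ i), φ.matrix.Realize M (sval v w)

/-- Bounded satisfiability of a set of Π₁-local formulas: for some bound `B`, every
finite subset of `Γ` together with every finite part of `B` is realized in a local
model of `T`. -/
def Pi1BoundedlySat {L : LocalLanguage} (T : Set (PosSentence L)) {α : Type}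
    {σ : α → L.Sorts} (Γ : Set (Pi1LForm L α σ)) : Prop :=
  ∃ B : VBound L α σ,
    ∀ Γ₀ ⊆ Γ, Γ₀.Finite → ∀ F ⊆ B.toSet, F.Finite →
      ∃ (M : LStructure L) (v : (a : α) → M.Dom (σ a)),
        LocalModel M T ∧ (∀ φ ∈ Γ₀, Pi1LForm.Realize φ M v) ∧
          (∀ ψ ∈ F, LPosForm.Realize M ψ v)

/-! ## Cardinality, homogeneity, retractors -/

/-- The cardinality of a structure: that of the disjoint union of its sorts. -/
def LStructure.card {L : LocalLanguage} (M : LStructure L) : Cardinal :=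
  Cardinal.mk (Σ s : L.Sorts, M.Dom s)

/-- The cardinality of a local language. -/
def LocalLanguage.card (L : LocalLanguage) : Cardinal :=
  max Cardinal.aleph0
    (Cardinal.mk (L.Sorts ⊕ (Σ s : L.Sorts, L.Const s) ⊕ (Σ s : L.Sorts, L.Loc s) ⊕
      (Σ (n : ℕ) (ρ : Fin n → L.Sorts), L.Rel n ρ)))

/-- `M` is a (local positively) κ-ultrahomogeneous model of `T`. -/
def IsUltrahomogeneous {L : LocalLanguage} (T : Set (PosSentence L)) (M : LStructure L)
    (κ : Cardinal) : Prop :=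
  ∀ A B : LStructure L, LocalModel A T → LocalModel B T → A.card < κ → B.card < κ →
    ∀ f : LHom A M, f.IsPosEmbedding → ∀ g : LHom A B, ∃ h : LHom B M, h.comp g = f

/-- A retractor of `T`: a local model of `T` such that every homomorphism into a local
model of `T` has a retraction. -/
def IsRetractor {L : LocalLanguage} (T : Set (PosSentence L)) (C : LStructure L) : Prop :=
  LocalModel C T ∧
    ∀ N : LStructure L, LocalModel N T →
      ∀ f : LHom C N, ∃ g : LHom N C, g.comp f = LHom.id C

/-- `M` is κ-universal for a class `K` of structures. -/
def IsUniversal {L : LocalLanguage} (M : LStructure L) (K : LStructure L → Prop)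
    (κ : Cardinal) : Prop :=
  ∀ N : LStructure L, K N → N.card < κ → Nonempty (LHom N M)

/-- `M` is absolutely universal for a class `K` of structures. -/
def IsAbsUniversal {L : LocalLanguage} (M : LStructure L) (K : LStructure L → Prop) : Prop :=
  ∀ N : LStructure L, K N → Nonempty (LHom N M)

/-- Compatibility of two local models of `T`. -/
def Compat {L : LocalLanguage} (T : Set (PosSentence L)) (A B : LStructure L) : Prop :=
  ∃ M : LStructure L, LocalModel M T ∧ Nonempty (LHom A M) ∧ Nonempty (LHom B M)

/-- The local joint (homomorphism) property. -/
def HasLJP {L : LocalLanguage} (T : Set (PosSentence L)) : Prop :=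
  ∀ A B : LStructure L, LocalModel A T → LocalModel B T →
    ∃ M : LStructure L, LocalModel M T ∧ Nonempty (LHom A M) ∧ Nonempty (LHom B M)


/-! ## Parameters -/

/-- A set of parameters in a structure. -/
def ParamSet {L : LocalLanguage} (M : LStructure L) := (s : L.Sorts) → Set (M.Dom s)

/-- Interpretation in `M` of old and new constants of the expanded language. -/
def paramInterp {L : LocalLanguage} (M : LStructure L) (A : ParamSet M) {s : L.Sorts} :
    L.Const s ⊕ (A s) → M.Dom s
  | .inl c => M.constMap c
  | .inr a => a.1

/-- The expansion `L(A)` of `L` by new constants for the parameters `A` of a local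
structure `M`; bounds for pairs involving the new constants are chosen (by locality
axiom (A5)) so that they hold in `M`. -/
noncomputable def LocalLanguage.withParams (L : LocalLanguage) (M : LStructure L)
    (hM : IsLocal M) (A : ParamSet M) : LocalLanguage where
  Sorts := L.Sorts
  Rel := L.Rel
  Const s := L.Const s ⊕ (A s)
  Loc := L.Loc
  locToRel := L.locToRel
  dd0 := L.dd0
  locMul := L.locMul
  locLe := L.locLe
  locMul_assoc := L.locMul_assoc
  dd0_locMul := L.dd0_locMul
  locMul_dd0 := L.locMul_dd0
  locLe_refl := L.locLe_refl
  locLe_trans := L.locLe_trans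
  locLe_antisymm := L.locLe_antisymm
  dd0_locLe := L.dd0_locLe
  locMul_mono := L.locMul_mono
  bound := fun {_s} c₁ c₂ =>
    match c₁, c₂ with
    | .inl c₁, .inl c₂ => L.bound c₁ c₂
    | c₁, c₂ => Classical.choose (hM.total (paramInterp M A c₁) (paramInterp M A c₂))

/-- The natural expansion `M_A` of `M` to an `L(A)`-structure. -/
noncomputable def LStructure.withParams {L : LocalLanguage} (M : LStructure L)
    (hM : IsLocal M) (A : ParamSet M) : LStructure (L.withParams M hM A) where
  Dom := M.Dom
  relMap := M.relMap
  constMap := paramInterp M A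

/-- `M` has the local joint property over `A`: any two local models of `Th₋(M/A)` map
into a common local model of `Th₋(M/A)`. -/
def HasLJPOver {L : LocalLanguage} (M : LStructure L) (hM : IsLocal M) (A : ParamSet M) :
    Prop :=
  HasLJP (ThNeg (M.withParams hM A))

/-- `M` is (local positively) κ-saturated: it realizes every local positive type of
`Th₋(M/A)` on `x` whenever `|x| < κ`, `|A| < κ` and `M` has the local joint property
over `A`. -/
def IsSaturatedAt {L : LocalLanguage} (M : LStructure L) (hM : IsLocal M)
    (κ : Cardinal) : Prop :=
  ∀ A : ParamSet M, Cardinal.mk (Σ s : L.Sorts, A s) < κ → HasLJPOver M hM A →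
    ∀ (α : Type) (σ : α → L.Sorts), Cardinal.mk α < κ →
      ∀ Γ : Set (LPosForm (L.withParams M hM A) α σ),
        IsLType (ThNeg (M.withParams hM A)) Γ →
          ∃ v : (a : α) → M.Dom (σ a), ∀ φ ∈ Γ, LPosForm.Realize (M.withParams hM A) φ v

/-- The local positive type of a tuple over a set of parameters `A`, rendered as the set
of local positive formulas with extra free variables for the parameters of `A` that are
satisfied when those variables are evaluated at the parameters themselves. -/
def ltpOver {L : LocalLanguage} (M : LStructure L) (A : ParamSet M) {α : Type}
    {σ : α → L.Sorts} (v : (a : α) → M.Dom (σ a)) :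
    Set (LPosForm L (α ⊕ Σ s : L.Sorts, A s) (Sum.elim σ (fun p => p.1))) :=
  {φ | φ.Realize M (sval v (fun p => p.2.1))}

/-! ## Substructures -/

/-- A substructure of `M`: a family of subsets closed under the constants (the language
is relational). -/
structure Substruct {L : LocalLanguage} (M : LStructure L) where
  carrier : (s : L.Sorts) → Set (M.Dom s)
  const_mem : ∀ {s : L.Sorts} (c : L.Const s), M.constMap c ∈ carrier s

/-- The induced structure on a substructure. -/
def Substruct.toStruct {L : LocalLanguage} {M : LStructure L} (A : Substruct M) :
    LStructure L where
  Dom s := A.carrier s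
  relMap R x := M.relMap R (fun i => (x i).1)
  constMap c := ⟨M.constMap c, A.const_mem c⟩


/-! ## Topologies -/

/-- The `d`-ball at `a`. -/
def LStructure.ball {L : LocalLanguage} (M : LStructure L) {s : L.Sorts} (d : L.Loc s)
    (a : M.Dom s) : Set (M.Dom s) :=
  {b | M.locRel d a b}

/-- The local positive logic topology on a single sort of `M`: closed sets are the
subsets defined by sets of local positive formulas with parameters in `M` (parameters
being rendered as extra free variables evaluated at themselves). -/
def lpTopologyS {L : LocalLanguage} (M : LStructure L) (s : L.Sorts) :
    TopologicalSpace (M.Dom s) :=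
  TopologicalSpace.generateFrom
    {U | ∃ φ : LPosForm L (Unit ⊕ Σ s' : L.Sorts, M.Dom s')
            (Sum.elim (fun _ => s) (fun p => p.1)),
      U = {x | ¬ LPosForm.Realize M φ (sval (fun _ => x) (fun p => p.2))}}

/-- The space of local positive types of `T` on the variable `(α, σ)`. -/
def LTypeSpace (L : LocalLanguage) (T : Set (PosSentence L)) (α : Type)
    (σ : α → L.Sorts) :=
  {Γ : Set (LPosForm L α σ) // IsLType T Γ}

/-- The local positive logic topology on the space of local positive types: generated by
declaring `⟨φ⟩ = {p : φ ∈ p}` closed for every local positive formula `φ`; its closed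
sets are then exactly the sets `⟨Γ⟩` together with `∅`. -/
instance {L : LocalLanguage} (T : Set (PosSentence L)) (α : Type) (σ : α → L.Sorts) :
    TopologicalSpace (LTypeSpace L T α σ) :=
  TopologicalSpace.generateFrom
    {U | ∃ φ : LPosForm L α σ, U = {p : LTypeSpace L T α σ | φ ∉ p.1}}

/-! ## Completeness and compactness -/

/-- `T` is complete: `T = Th₋(M)` for every local positively closed model `M` of `T`. -/
def IsCompleteTheory {L : LocalLanguage} (T : Set (PosSentence L)) : Prop :=
  ∀ M : LStructure L, IsPC M T → ThNeg M = T

/-- `T` is local positively compact. -/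
def IsLocPosCompact {L : LocalLanguage} (T : Set (PosSentence L)) : Prop :=
  ∀ (s : L.Sorts) (γ : Type), Finite γ →
    ∀ (τ : γ → L.Sorts) (φ : LPosForm L (Fin 2 ⊕ γ) (Sum.elim (fun _ => s) τ)),
      (∀ M : LStructure L, LocalModel M T →
        ∀ (a : M.Dom s) (w : (j : γ) → M.Dom (τ j)),
          ¬ LPosForm.Realize M φ (sval ![a, a] w)) →
      ∀ (B : VBound L (Unit ⊕ γ) (Sum.elim (fun _ => s) τ)) (d : L.Loc s),
        ∃ k : ℕ, 0 < k ∧ ∀ M : LStructure L, LocalModel M T →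
          ¬ ∃ (a : Fin k → M.Dom s) (w : (j : γ) → M.Dom (τ j)),
            ∀ i j : Fin k, i ≠ j →
              B.Holds M (sval (fun _ => a i) w) ∧ M.locRel d (a i) (a j) ∧
                LPosForm.Realize M φ (sval ![a i, a j] w)

/-! ## Auxiliary facts -/

@[ext]
theorem LHom.ext {L : LocalLanguage} {M N : LStructure L} {f g : LHom M N}
    (h : ∀ s x, f.toFun s x = g.toFun s x) : f = g := by
  cases f
  cases g
  congr
  funext s x
  exact h s x

theorem dpair_comp {C D : Fin 2 → Type} (g : ∀ i, C i → D i) (a : C 0) (b : C 1) :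
    (fun i => g i (dpair a b i)) = dpair (g 0 a) (g 1 b) := by
  funext i
  match i with
  | ⟨0, _⟩ => rfl
  | ⟨1, _⟩ => rfl

theorem dpair_eta {C : Fin 2 → Type} (z : ∀ i, C i) : z = dpair (z 0) (z 1) := by
  funext i
  match i with
  | ⟨0, _⟩ => rfl
  | ⟨1, _⟩ => rfl

theorem LHom.map_locRel {L : LocalLanguage} {M N : LStructure L} (f : LHom M N) {s : L.Sorts}
    {d : L.Loc s} {a b : M.Dom s} (h : M.locRel d a b) :
    N.locRel d (f.toFun s a) (f.toFun s b) := by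
  have := f.map_rel _ _ h
  rwa [dpair_comp (C := fun i => M.Dom (![s, s] i)) (fun i => f.toFun (![s, s] i)) a b] at this

theorem comp_vcons {L : LocalLanguage} {M N : LStructure L} (f : ∀ s, M.Dom s → N.Dom s)
    {α : Type} {σ : α → L.Sorts} {s : L.Sorts} (x : M.Dom s) (v : ∀ a, M.Dom (σ a)) :
    (fun o => f _ (vcons x v o)) = vcons (f s x) (fun a => f _ (v a)) := by
  funext o
  cases o <;> rfl

theorem LHom.map_term {L : LocalLanguage} {M N : LStructure L} (f : LHom M N) {α : Type}
    {σ : α → L.Sorts} (v : ∀ a, M.Dom (σ a)) {s : L.Sorts} (t : LTerm L α σ s) :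
    f.toFun s (t.realize M v) = t.realize N (fun a => f.toFun _ (v a)) := by
  cases t with
  | var a => rfl
  | const c => exact f.map_const c

theorem PosForm.Realize.map {L : LocalLanguage} {M N : LStructure L} (f : LHom M N) {α : Type}
    {σ : α → L.Sorts} {φ : PosForm L α σ} {v : ∀ a, M.Dom (σ a)} (h : φ.Realize M v) :
    φ.Realize N (fun a => f.toFun _ (v a)) := by
  induction φ with
  | rel R ts =>
    have := f.map_rel _ _ h
    simp only [LHom.map_term] at this
    exact this
  | and φ ψ ihφ ihψ => exact ⟨ihφ h.1, ihψ h.2⟩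
  | or φ ψ ihφ ihψ => exact h.imp ihφ ihψ
  | ex s φ ih =>
    obtain ⟨x, hx⟩ := h
    have := ih hx
    rw [comp_vcons f.toFun] at this
    exact ⟨_, this⟩

theorem LPosForm.Realize.map {L : LocalLanguage} {M N : LStructure L} (f : LHom M N) {α : Type}
    {σ : α → L.Sorts} {φ : LPosForm L α σ} {v : ∀ a, M.Dom (σ a)} (h : φ.Realize M v) :
    φ.Realize N (fun a => f.toFun _ (v a)) := by
  induction φ with
  | rel R ts =>
    have := f.map_rel _ _ h
    simp only [LHom.map_term] at this
    exact this
  | and φ ψ ihφ ihψ => exact ⟨ihφ h.1, ihψ h.2⟩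
  | or φ ψ ihφ ihψ => exact h.imp ihφ ihψ
  | lex s d t φ ih =>
    obtain ⟨x, hd, hx⟩ := h
    have h1 := ih hx
    have h2 := f.map_locRel hd
    rw [comp_vcons f.toFun] at h1
    rw [LHom.map_term] at h2
    exact ⟨_, h2, h1⟩

/-! ### Terms and formulas -/

/-- Weakening of a term by one variable. -/
def LTerm.weaken {L : LocalLanguage} {α : Type} {σ : α → L.Sorts} (s : L.Sorts) :
    {t : L.Sorts} → LTerm L α σ t → LTerm L (Option α) (osort s σ) t
  | _, .var a => .var (σ := osort s σ) (some a)
  | _, .const c => .const c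

theorem LTerm.realize_weaken {L : LocalLanguage} {M : LStructure L} {α : Type}
    {σ : α → L.Sorts} {s : L.Sorts} (x : M.Dom s) (v : ∀ a, M.Dom (σ a)) {t : L.Sorts}
    (u : LTerm L α σ t) : (u.weaken s).realize M (vcons x v) = u.realize M v := by
  cases u <;> rfl

/-- The most recently added variable. -/
def LTerm.newest {L : LocalLanguage} {α : Type} {σ : α → L.Sorts} (s : L.Sorts) :
    LTerm L (Option α) (osort s σ) s :=
  .var (σ := osort s σ) none

theorem realize_tpair {L : LocalLanguage} {M : LStructure L} {α : Type} {σ : α → L.Sorts}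
    {s : L.Sorts} (t u : LTerm L α σ s) (v : ∀ a, M.Dom (σ a)) :
    (fun i => (tpair t u i).realize M v) =
      dpair (C := fun i => M.Dom (![s, s] i)) (t.realize M v) (u.realize M v) := by
  funext i
  match i with
  | ⟨0, _⟩ => rfl
  | ⟨1, _⟩ => rfl

/-- Simultaneous substitution in a term. -/
def LTerm.subst {L : LocalLanguage} {α β : Type} {σ : α → L.Sorts} {τ : β → L.Sorts}
    (g : ∀ a, LTerm L β τ (σ a)) : {t : L.Sorts} → LTerm L α σ t → LTerm L β τ t
  | _, .var a => g a
  | _, .const c => .const c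

theorem LTerm.realize_subst {L : LocalLanguage} {M : LStructure L} {α β : Type}
    {σ : α → L.Sorts} {τ : β → L.Sorts} (g : ∀ a, LTerm L β τ (σ a)) (v : ∀ b, M.Dom (τ b))
    {t : L.Sorts} (u : LTerm L α σ t) :
    (u.subst g).realize M v = u.realize M (fun a => (g a).realize M v) := by
  cases u <;> rfl

/-- Extension of a substitution by a fresh variable. -/
def substLift {L : LocalLanguage} {α β : Type} {σ : α → L.Sorts} {τ : β → L.Sorts}
    (s : L.Sorts) (g : ∀ a, LTerm L β τ (σ a)) :
    (o : Option α) → LTerm L (Option β) (osort s τ) (osort s σ o)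
  | none => .var (σ := osort s τ) none
  | some a => (g a).weaken s

theorem realize_substLift {L : LocalLanguage} {M : LStructure L} {α β : Type}
    {σ : α → L.Sorts} {τ : β → L.Sorts} {s : L.Sorts} (g : ∀ a, LTerm L β τ (σ a))
    (x : M.Dom s) (v : ∀ b, M.Dom (τ b)) :
    (fun o => (substLift s g o).realize M (vcons x v)) =
      vcons x (fun a => (g a).realize M v) := by
  funext o
  cases o with
  | none => rfl
  | some a => exact LTerm.realize_weaken x v (g a)

theorem LPosForm.exists_subst {L : LocalLanguage} {α : Type} {σ : α → L.Sorts}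
    (φ : LPosForm L α σ) : ∀ {β : Type} {τ : β → L.Sorts} (g : ∀ a, LTerm L β τ (σ a)),
    ∃ ψ : LPosForm L β τ, ∀ (M : LStructure L) (v : ∀ b, M.Dom (τ b)),
      ψ.Realize M v ↔ φ.Realize M (fun a => (g a).realize M v) := by
  induction φ with
  | rel R ts =>
    intro β τ g
    refine ⟨.rel R (fun i => (ts i).subst g), fun M v => ?_⟩
    simp only [LPosForm.Realize, LTerm.realize_subst]
  | and φ ψ ihφ ihψ =>
    intro β τ g
    obtain ⟨φ', hφ⟩ := ihφ g
    obtain ⟨ψ', hψ⟩ := ihψ g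
    exact ⟨.and φ' ψ', fun M v => and_congr (hφ M v) (hψ M v)⟩
  | or φ ψ ihφ ihψ =>
    intro β τ g
    obtain ⟨φ', hφ⟩ := ihφ g
    obtain ⟨ψ', hψ⟩ := ihψ g
    exact ⟨.or φ' ψ', fun M v => or_congr (hφ M v) (hψ M v)⟩
  | lex s d t φ ih =>
    intro β τ g
    obtain ⟨φ', hφ⟩ := ih (substLift s g)
    refine ⟨.lex s d (t.subst g) φ', fun M v => ?_⟩
    simp only [LPosForm.Realize, LTerm.realize_subst, hφ, realize_substLift]

theorem LPosForm.exists_posForm {L : LocalLanguage} {α : Type} {σ : α → L.Sorts}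
    (φ : LPosForm L α σ) : ∃ ψ : PosForm L α σ, ∀ (M : LStructure L) (v : ∀ a, M.Dom (σ a)),
      ψ.Realize M v ↔ φ.Realize M v := by
  induction φ with
  | rel R ts => exact ⟨.rel R ts, fun M v => Iff.rfl⟩
  | and φ ψ ihφ ihψ =>
    obtain ⟨φ', hφ⟩ := ihφ
    obtain ⟨ψ', hψ⟩ := ihψ
    exact ⟨.and φ' ψ', fun M v => and_congr (hφ M v) (hψ M v)⟩
  | or φ ψ ihφ ihψ =>
    obtain ⟨φ', hφ⟩ := ihφ
    obtain ⟨ψ', hψ⟩ := ihψ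
    exact ⟨.or φ' ψ', fun M v => or_congr (hφ M v) (hψ M v)⟩
  | @lex α σ s d t φ ih =>
    obtain ⟨φ', hφ⟩ := ih
    refine ⟨.ex s (.and (.rel (L.locToRel d)
      (tpair (LTerm.newest s) (t.weaken s))) φ'), fun M v => ?_⟩
    simp only [LPosForm.Realize, PosForm.Realize, hφ]
    refine exists_congr fun x => and_congr_left fun _ => ?_
    rw [realize_tpair, LTerm.realize_weaken]
    rfl

theorem realize_rel_tpair {L : LocalLanguage} {M : LStructure L} {α : Type} {σ : α → L.Sorts}
    {s : L.Sorts} (d : L.Loc s) (t u : LTerm L α σ s) (v : ∀ a, M.Dom (σ a)) :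
    (LPosForm.rel (L.locToRel d) (tpair t u)).Realize M v ↔
      M.locRel d (t.realize M v) (u.realize M v) := by
  simp only [LPosForm.Realize, LStructure.locRel]
  rw [realize_tpair]

/-! ### Local structures -/

theorem IsLocal.refl {L : LocalLanguage} {M : LStructure L} (hM : IsLocal M) {s : L.Sorts}
    (d : L.Loc s) (a : M.Dom s) : M.locRel d a a :=
  hM.mono _ _ (L.dd0_locLe d) _ _ ((hM.dd0_eq a a).2 rfl)

theorem LHom.IsPosEmbedding.injective {L : LocalLanguage} {M N : LStructure L}
    (hM : IsLocal M) (hN : IsLocal N) {f : LHom M N} (hf : f.IsPosEmbedding) (s : L.Sorts) :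
    Function.Injective (f.toFun s) := by
  intro a b hab
  obtain ⟨ψ, hψ⟩ := LPosForm.exists_posForm (LPosForm.rel (α := Fin 2) (σ := fun _ => s)
    (L.locToRel (L.dd0 s)) (tpair (LTerm.var (σ := fun _ => s) 0) (LTerm.var (σ := fun _ => s) 1)))
  have := hf _ _ ψ ![a, b] (by
    rw [hψ, realize_rel_tpair, hN.dd0_eq]
    exact hab)
  rw [hψ, realize_rel_tpair, hM.dd0_eq] at this
  exact this

theorem LHom.IsPosEmbedding.reflect_rel {L : LocalLanguage} {M N : LStructure L}
    {f : LHom M N} (hf : f.IsPosEmbedding) {n : ℕ} {ρ : Fin n → L.Sorts} (R : L.Rel n ρ)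
    (x : ∀ i, M.Dom (ρ i)) (h : N.relMap R (fun i => f.toFun _ (x i))) : M.relMap R x :=
  hf (Fin n) ρ (.rel R (fun i => .var i)) x h

theorem LHom.IsPosEmbedding.reflect_locRel {L : LocalLanguage} {M N : LStructure L}
    {f : LHom M N} (hf : f.IsPosEmbedding) {s : L.Sorts} {d : L.Loc s} {a b : M.Dom s}
    (h : N.locRel d (f.toFun s a) (f.toFun s b)) : M.locRel d a b := by
  refine hf.reflect_rel _ _ ?_
  rw [dpair_comp (C := fun i => M.Dom (![s, s] i)) (fun i => f.toFun (![s, s] i)) a b]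
  exact h

theorem LHom.IsPosEmbedding.nonempty {L : LocalLanguage} {M N : LStructure L}
    (hN : IsLocal N) {f : LHom M N} (hf : f.IsPosEmbedding) {s : L.Sorts}
    (h : Nonempty (N.Dom s)) : Nonempty (M.Dom s) := by
  obtain ⟨b⟩ := h
  obtain ⟨ψ, hψ⟩ := LPosForm.exists_posForm (LPosForm.rel (α := Option Empty)
    (σ := osort s (emptySorts L)) (L.locToRel (L.dd0 s))
    (tpair (LTerm.newest s) (LTerm.newest s)))
  obtain ⟨x, -⟩ := hf Empty (emptySorts L) (.ex s ψ) (fun e => e.elim)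
    ⟨b, by rw [hψ, realize_rel_tpair]; exact hN.refl _ _⟩
  exact ⟨x⟩

/-- A structure embedded in a local model is a local model. -/
theorem LocalModel.of_embedding {L : LocalLanguage} {T : Set (PosSentence L)}
    {M N : LStructure L} (hN : LocalModel N T) (f : LHom M N)
    (hrel : ∀ {n : ℕ} {ρ : Fin n → L.Sorts} (R : L.Rel n ρ) (x : ∀ i, M.Dom (ρ i)),
      N.relMap R (fun i => f.toFun _ (x i)) → M.relMap R x)
    (hinj : ∀ s, Function.Injective (f.toFun s)) : LocalModel M T := by
  have key : ∀ {s : L.Sorts} (d : L.Loc s) (a b : M.Dom s),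
      M.locRel d a b ↔ N.locRel d (f.toFun s a) (f.toFun s b) := by
    intro s d a b
    refine ⟨f.map_locRel, fun h => hrel _ _ ?_⟩
    rw [dpair_comp (C := fun i => M.Dom (![s, s] i)) (fun i => f.toFun (![s, s] i)) a b]
    exact h
  refine ⟨⟨?_, ?_, ?_, ?_, ?_, ?_⟩, ?_⟩
  · intro s d a b h
    rw [key] at h ⊢
    exact hN.1.symm _ _ _ h
  · intro s d₁ d₂ hd a b h
    rw [key] at h ⊢
    exact hN.1.mono _ _ hd _ _ h
  · intro s d₁ d₂ a b c h h'
    rw [key] at h h' ⊢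
    exact hN.1.comp _ _ _ _ _ h h'
  · intro s c₁ c₂
    rw [key, f.map_const, f.map_const]
    exact hN.1.boundAx _ _
  · intro s a b
    simp only [key]
    exact hN.1.total _ _
  · intro s a b
    rw [key, hN.1.dd0_eq]
    exact (hinj s).eq_iff
  · intro φ hφ h
    refine hN.2 φ hφ ?_
    have := PosForm.Realize.map f h
    unfold PosSentence.RealizedIn
    convert this using 1

/-! ### Reduced limits of partial maps into local models -/

/-- A relation holds of the images of a tuple under a partial map. -/
def PHolds {L : LocalLanguage} (B : LStructure L) {Y : L.Sorts → Type}
    (h : ∀ s, Y s → Option (B.Dom s)) {n : ℕ} {ρ : Fin n → L.Sorts} (R : L.Rel n ρ)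
    (y : ∀ i, Y (ρ i)) : Prop :=
  ∃ z : ∀ i, B.Dom (ρ i), (∀ i, h _ (y i) = some (z i)) ∧ B.relMap R z

theorem pholds_loc {L : LocalLanguage} {B : LStructure L} {Y : L.Sorts → Type}
    {h : ∀ s, Y s → Option (B.Dom s)} {s : L.Sorts} {d : L.Loc s} {y y' : Y s} :
    PHolds B h (L.locToRel d) (dpair (C := fun i => Y (![s, s] i)) y y') ↔
      ∃ z z', h s y = some z ∧ h s y' = some z' ∧ B.locRel d z z' := by
  constructor
  · rintro ⟨z, hz, hR⟩
    refine ⟨z 0, z 1, hz 0, hz 1, ?_⟩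
    rw [dpair_eta z] at hR
    exact hR
  · rintro ⟨z, z', hz, hz', hR⟩
    refine ⟨dpair (C := fun i => B.Dom (![s, s] i)) z z', fun i => ?_, hR⟩
    match i with
    | ⟨0, _⟩ => exact hz
    | ⟨1, _⟩ => exact hz'

section Limit

variable {L : LocalLanguage} {I : Type*} (l : Filter I) (B : I → LStructure L)
  (Y : L.Sorts → Type) (h : ∀ i s, Y s → Option ((B i).Dom s))
  (cst : ∀ s, L.Const s → Y s)

/-- Names are identified when their images eventually agree. -/
def limSetoid (s : L.Sorts) : Setoid (Y s) where
  r y y' := ∀ᶠ i in l, h i s y = h i s y'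
  iseqv :=
    { refl := fun _ => Filter.Eventually.of_forall fun _ => rfl
      symm := fun H => H.mono fun _ e => e.symm
      trans := fun H H' => (H.and H').mono fun _ e => e.1.trans e.2 }

/-- The limit of a family of structures along partial maps out of a family of names. -/
def limStructure : LStructure L where
  Dom s := Quotient (limSetoid l B Y h s)
  relMap R x := ∀ᶠ i in l, PHolds (B i) (h i) R (fun j => (x j).out)
  constMap {s} c := Quotient.mk _ (cst s c)

/-- The element of the limit with a given name. -/
def limMk (s : L.Sorts) (y : Y s) : (limStructure l B Y h cst).Dom s :=
  Quotient.mk (limSetoid l B Y h s) y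

theorem limMk_surjective (s : L.Sorts) : Function.Surjective (limMk l B Y h cst s) :=
  Quotient.mk_surjective

theorem limMk_eq {s : L.Sorts} {y y' : Y s} :
    limMk l B Y h cst s y = limMk l B Y h cst s y' ↔ ∀ᶠ i in l, h i s y = h i s y' :=
  Quotient.eq (r := limSetoid l B Y h s)

theorem limStructure_relMap {n : ℕ} {ρ : Fin n → L.Sorts} (R : L.Rel n ρ)
    (y : ∀ i, Y (ρ i)) :
    (limStructure l B Y h cst).relMap R (fun j => limMk l B Y h cst _ (y j)) ↔
      ∀ᶠ i in l, PHolds (B i) (h i) R y := by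
  have hout : ∀ᶠ i in l, ∀ j,
      h i _ (Quotient.out (limMk l B Y h cst _ (y j))) = h i _ (y j) := by
    rw [Filter.eventually_all]
    intro j
    exact (limMk_eq l B Y h cst).1
      (Quotient.out_eq (s := limSetoid l B Y h (ρ j)) (limMk l B Y h cst _ (y j)))
  refine Filter.eventually_congr (hout.mono fun i hi => ?_)
  refine exists_congr fun z => and_congr_left fun _ => forall_congr' fun j => ?_
  rw [← hi j]

theorem limStructure_locRel {s : L.Sorts} (d : L.Loc s) (y y' : Y s) :
    (limStructure l B Y h cst).locRel d (limMk l B Y h cst s y) (limMk l B Y h cst s y') ↔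
      ∀ᶠ i in l, ∃ z z', h i s y = some z ∧ h i s y' = some z' ∧ (B i).locRel d z z' := by
  have := limStructure_relMap l B Y h cst (L.locToRel d)
    (dpair (C := fun i => Y (![s, s] i)) y y')
  rw [dpair_comp (C := fun i => Y (![s, s] i))
    (D := fun i => (limStructure l B Y h cst).Dom (![s, s] i))
    (fun i => limMk l B Y h cst (![s, s] i)) y y'] at this
  simp only [pholds_loc] at this
  exact this

/-- Extension of a naming of variables by one name. -/
def nameCons {α : Type} {σ : α → L.Sorts} {s : L.Sorts} (x : Y s) (y : ∀ a, Y (σ a)) :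
    (o : Option α) → Y (osort s σ o)
  | none => x
  | some a => y a

theorem limStructure_realize
    (hcst : ∀ s (c : L.Const s), ∀ᶠ i in l, h i s (cst s c) = some ((B i).constMap c))
    (hdef : ∀ s (y : Y s), ∀ᶠ i in l, ∃ z, h i s y = some z)
    {α : Type} {σ : α → L.Sorts} (φ : PosForm L α σ) : ∀ y : ∀ a, Y (σ a),
      φ.Realize (limStructure l B Y h cst) (fun a => limMk l B Y h cst _ (y a)) →
        ∀ᶠ i in l, ∀ v : ∀ a, (B i).Dom (σ a), (∀ a, h i _ (y a) = some (v a)) →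
          φ.Realize (B i) v := by
  induction φ with
  | @rel α σ n ρ R ts =>
    intro y hR
    have hterm : ∀ j : Fin n, ∃ x : Y (ρ j),
        (ts j).realize (limStructure l B Y h cst) (fun a => limMk l B Y h cst _ (y a)) =
          limMk l B Y h cst _ x ∧
        ∀ᶠ i in l, ∀ v : ∀ a, (B i).Dom (σ a), (∀ a, h i _ (y a) = some (v a)) →
          h i _ x = some ((ts j).realize (B i) v) := by
      intro j
      generalize ts j = t
      generalize ρ j = s at t
      cases t with
      | var a => exact ⟨y a, rfl, Filter.Eventually.of_forall fun i v hv => hv a⟩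
      | const c => exact ⟨cst _ c, rfl, (hcst _ c).mono fun i hi v _ => hi⟩
    choose x hx hx' using hterm
    have hR' : (limStructure l B Y h cst).relMap R (fun j => limMk l B Y h cst _ (x j)) := by
      simp only [← hx]
      exact hR
    rw [limStructure_relMap] at hR'
    filter_upwards [hR', Filter.eventually_all.2 hx'] with i hi hi' v hv
    obtain ⟨z, hz, hRz⟩ := hi
    have : z = fun j => (ts j).realize (B i) v := by
      funext j
      exact Option.some_injective _ ((hz j).symm.trans (hi' j v hv))
    rw [this] at hRz
    exact hRz
  | and φ ψ ihφ ihψ =>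
    intro y hy
    filter_upwards [ihφ y hy.1, ihψ y hy.2] with i h1 h2 v hv using ⟨h1 v hv, h2 v hv⟩
  | or φ ψ ihφ ihψ =>
    intro y hy
    rcases hy with hy | hy
    · filter_upwards [ihφ y hy] with i h1 v hv using Or.inl (h1 v hv)
    · filter_upwards [ihψ y hy] with i h1 v hv using Or.inr (h1 v hv)
  | @ex α σ s φ ih =>
    intro y hy
    obtain ⟨x, hx⟩ := hy
    obtain ⟨x, rfl⟩ := limMk_surjective l B Y h cst s x
    have e : vcons (limMk l B Y h cst s x) (fun a => limMk l B Y h cst _ (y a)) =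
        fun o => limMk l B Y h cst _ (nameCons Y (s := s) x y o) := by
      funext o
      cases o <;> rfl
    rw [e] at hx
    filter_upwards [ih _ hx, hdef s x] with i h1 h2 v hv
    obtain ⟨z, hz⟩ := h2
    refine ⟨z, h1 _ fun o => ?_⟩
    cases o with
    | none => exact hz
    | some a => exact hv a

theorem limStructure_localModel [l.NeBot] {T : Set (PosSentence L)}
    (hB : ∀ i, LocalModel (B i) T)
    (hcst : ∀ s (c : L.Const s), ∀ᶠ i in l, h i s (cst s c) = some ((B i).constMap c))
    (htot : ∀ s (y y' : Y s), ∃ d : L.Loc s, ∀ᶠ i in l,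
      ∃ z z', h i s y = some z ∧ h i s y' = some z' ∧ (B i).locRel d z z') :
    LocalModel (limStructure l B Y h cst) T := by
  have hdef : ∀ s (y : Y s), ∀ᶠ i in l, ∃ z, h i s y = some z := by
    intro s y
    obtain ⟨d, hd⟩ := htot s y y
    exact hd.mono fun i ⟨z, _, hz, _⟩ => ⟨z, hz⟩
  refine ⟨⟨?_, ?_, ?_, ?_, ?_, ?_⟩, ?_⟩
  · intro s d a b hab
    obtain ⟨a, rfl⟩ := limMk_surjective l B Y h cst s a
    obtain ⟨b, rfl⟩ := limMk_surjective l B Y h cst s b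
    rw [limStructure_locRel] at hab ⊢
    filter_upwards [hab] with i ⟨z, z', hz, hz', hd⟩
    exact ⟨z', z, hz', hz, (hB i).1.symm _ _ _ hd⟩
  · intro s d₁ d₂ hle a b hab
    obtain ⟨a, rfl⟩ := limMk_surjective l B Y h cst s a
    obtain ⟨b, rfl⟩ := limMk_surjective l B Y h cst s b
    rw [limStructure_locRel] at hab ⊢
    filter_upwards [hab] with i ⟨z, z', hz, hz', hd⟩
    exact ⟨z, z', hz, hz', (hB i).1.mono _ _ hle _ _ hd⟩
  · intro s d₁ d₂ a b c hab hbc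
    obtain ⟨a, rfl⟩ := limMk_surjective l B Y h cst s a
    obtain ⟨b, rfl⟩ := limMk_surjective l B Y h cst s b
    obtain ⟨c, rfl⟩ := limMk_surjective l B Y h cst s c
    rw [limStructure_locRel] at hab hbc ⊢
    filter_upwards [hab, hbc] with i ⟨z, z', hz, hz', hd⟩ ⟨w, w', hw, hw', hd'⟩
    obtain rfl : z' = w := Option.some_injective _ (hz'.symm.trans hw)
    exact ⟨z, w', hz, hw', (hB i).1.comp _ _ _ _ _ hd hd'⟩
  · intro s c₁ c₂
    refine (limStructure_locRel l B Y h cst _ (cst s c₁) (cst s c₂)).2 ?_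
    filter_upwards [hcst s c₁, hcst s c₂] with i h1 h2
    exact ⟨_, _, h1, h2, (hB i).1.boundAx _ _⟩
  · intro s a b
    obtain ⟨a, rfl⟩ := limMk_surjective l B Y h cst s a
    obtain ⟨b, rfl⟩ := limMk_surjective l B Y h cst s b
    simp only [limStructure_locRel]
    exact htot s a b
  · intro s a b
    obtain ⟨a, rfl⟩ := limMk_surjective l B Y h cst s a
    obtain ⟨b, rfl⟩ := limMk_surjective l B Y h cst s b
    rw [limStructure_locRel, limMk_eq]
    constructor
    · intro H
      filter_upwards [H] with i ⟨z, z', hz, hz', hd⟩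
      rw [hz, hz', ((hB i).1.dd0_eq _ _).1 hd]
    · intro H
      filter_upwards [H, hdef s a] with i e ⟨z, hz⟩
      exact ⟨z, z, hz, e ▸ hz, ((hB i).1.dd0_eq _ _).2 rfl⟩
  · intro φ hφ H
    have e : (fun e => e.elim : ∀ e, (limStructure l B Y h cst).Dom (emptySorts L e)) =
        fun e => limMk l B Y h cst _ (e.elim : Y (emptySorts L e)) := by
      funext e
      exact e.elim
    have H' : φ.Realize (limStructure l B Y h cst)
        (fun e => limMk l B Y h cst _ (e.elim : Y (emptySorts L e))) := by
      rw [← e]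
      exact H
    obtain ⟨i, hi⟩ := (limStructure_realize l B Y h cst hcst hdef φ _ H').exists
    exact (hB i).2 φ hφ (hi _ fun e => e.elim)

end Limit

/-! ### Facts and separated models -/

/-- The positive diagram of a structure: its true atomic facts and its constants. -/
abbrev DFact {L : LocalLanguage} (N : LStructure L) : Type :=
  (Σ (n : ℕ) (ρ : Fin n → L.Sorts) (R : L.Rel n ρ),
    {x : ∀ i, N.Dom (ρ i) // N.relMap R x}) ⊕ (Σ s, L.Const s)

/-- A partial map preserves a fact. -/
def DFact.Holds {L : LocalLanguage} {N : LStructure L} (B : LStructure L)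
    (h : ∀ s, N.Dom s → Option (B.Dom s)) : DFact N → Prop
  | .inl f => PHolds B h f.2.2.1 f.2.2.2.1
  | .inr c => h c.1 (N.constMap c.2) = some (B.constMap c.2)

/-- The fact that a locality relation holds of two elements. -/
def DFact.loc {L : LocalLanguage} {N : LStructure L} {s : L.Sorts} {d : L.Loc s}
    {a b : N.Dom s} (H : N.locRel d a b) : DFact N :=
  .inl ⟨2, ![s, s], L.locToRel d, dpair a b, H⟩

theorem DFact.holds_loc {L : LocalLanguage} {N B : LStructure L}
    {h : ∀ s, N.Dom s → Option (B.Dom s)} {s : L.Sorts} {d : L.Loc s}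
    {a b : N.Dom s} {H : N.locRel d a b} :
    (DFact.loc H).Holds B h ↔ ∃ z z', h s a = some z ∧ h s b = some z' ∧ B.locRel d z z' :=
  pholds_loc

/-- A structure is separated if any two distinct elements are kept distinct by every partial
map into a local model preserving some finite part of the diagram. -/
def IsSeparated {L : LocalLanguage} (T : Set (PosSentence L)) (N : LStructure L) : Prop :=
  ∀ (s : L.Sorts) (a b : N.Dom s), a ≠ b → ∃ F : Finset (DFact N),
    ∀ (B : LStructure L) (h : ∀ s, N.Dom s → Option (B.Dom s)), LocalModel B T →
      (∀ f ∈ F, f.Holds B h) → ∀ z, h s a = some z → h s b ≠ some z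

/-- The image of a fact under a homomorphism. -/
def DFact.map {L : LocalLanguage} {M N : LStructure L} (g : LHom M N) : DFact M → DFact N
  | .inl f => .inl ⟨f.1, f.2.1, f.2.2.1, fun i => g.toFun _ (f.2.2.2.1 i),
      g.map_rel _ _ f.2.2.2.2⟩
  | .inr c => .inr c

theorem DFact.Holds.of_map {L : LocalLanguage} {M N B : LStructure L} {g : LHom M N}
    {f : DFact M} {h : ∀ s, N.Dom s → Option (B.Dom s)} (H : (f.map g).Holds B h) :
    f.Holds B (fun s x => h s (g.toFun s x)) := by
  rcases f with f | c
  · exact H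
  · have : h c.1 (N.constMap c.2) = some (B.constMap c.2) := H
    rw [← g.map_const] at this
    exact this

theorem DFact.holds_hom {L : LocalLanguage} {M N : LStructure L} (g : LHom M N) (f : DFact M) :
    f.Holds N (fun s x => some (g.toFun s x)) := by
  rcases f with f | c
  · exact ⟨_, fun _ => rfl, g.map_rel _ _ f.2.2.2.2⟩
  · exact congrArg some (g.map_const c.2)

/-- In a separated structure every homomorphism to a local model is injective. -/
theorem IsSeparated.injective {L : LocalLanguage} {T : Set (PosSentence L)}
    {M N : LStructure L} (hM : IsSeparated T M) (hN : LocalModel N T) (g : LHom M N)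
    (s : L.Sorts) : Function.Injective (g.toFun s) := by
  intro a b hab
  by_contra hne
  obtain ⟨F, hF⟩ := hM s a b hne
  exact hF N _ hN (fun f _ => f.holds_hom g) _ rfl (congrArg some hab.symm)

theorem isSeparated_of_injective {L : LocalLanguage} {T : Set (PosSentence L)}
    {N : LStructure L} (hN : LocalModel N T)
    (hinj : ∀ (N' : LStructure L) (g : LHom N N'), LocalModel N' T →
      ∀ s, Function.Injective (g.toFun s)) : IsSeparated T N := by
  classical
  intro s a b hab
  by_contra! hcon
  choose B h hB hF z hz hz' using hcon
  have hev : ∀ f : DFact N, ∀ᶠ F : Finset (DFact N) in Filter.atTop, f.Holds (B F) (h F) :=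
    fun f => (Filter.eventually_ge_atTop {f}).mono fun F hle =>
      hF F f (hle (Finset.mem_singleton_self f))
  have hcst : ∀ s (c : L.Const s), ∀ᶠ F : Finset (DFact N) in Filter.atTop,
      h F s (N.constMap c) = some ((B F).constMap c) := fun s c => hev (.inr ⟨s, c⟩)
  have hmodel := limStructure_localModel Filter.atTop B N.Dom h (fun s c => N.constMap c) hB hcst
    (fun s y y' => by
      obtain ⟨d, hd⟩ := hN.1.total y y'
      exact ⟨d, (hev (DFact.loc hd)).mono fun F H => DFact.holds_loc.1 H⟩)
  let g : LHom N (limStructure Filter.atTop B N.Dom h (fun s c => N.constMap c)) :=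
    { toFun := fun s => limMk _ _ _ _ _ s
      map_rel := fun {n ρ} R x H => (limStructure_relMap _ _ _ _ _ R x).2
        (hev (.inl ⟨n, ρ, R, x, H⟩))
      map_const := fun c => rfl }
  exact hab (hinj _ g hmodel s ((limMk_eq _ _ _ _ _).2
    (Filter.Eventually.of_forall fun F => (hz F).trans (hz' F).symm)))

/-- Every local model maps to a separated one. -/
theorem exists_separated {L : LocalLanguage} {T : Set (PosSentence L)} {N : LStructure L}
    (hN : LocalModel N T) :
    ∃ (N₁ : LStructure L) (_ : LHom N N₁), LocalModel N₁ T ∧ IsSeparated T N₁ := by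
  let ker : (N' : LStructure L) → LHom N N' → Set (Σ s, N.Dom s × N.Dom s) :=
    fun N' g => {p | g.toFun p.1 p.2.1 = g.toFun p.1 p.2.2}
  let K : Set (Set (Σ s, N.Dom s × N.Dom s)) :=
    {k | ∃ (N' : LStructure L) (g : LHom N N'), LocalModel N' T ∧
      (∀ s, Function.Surjective (g.toFun s)) ∧ k = ker N' g}
  have limit : ∀ {I : Type} (l : Filter I) [l.NeBot] (B : I → LStructure L)
      (g : ∀ i, LHom N (B i)), (∀ i, LocalModel (B i) T) →
      ∃ (N' : LStructure L) (g' : LHom N N'), LocalModel N' T ∧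
        (∀ s, Function.Surjective (g'.toFun s)) ∧
        ∀ p, p ∈ ker N' g' ↔ ∀ᶠ i in l, p ∈ ker (B i) (g i) := by
    intro I l _ B g hB
    let h : ∀ i s, N.Dom s → Option ((B i).Dom s) := fun i s x => some ((g i).toFun s x)
    refine ⟨limStructure l B N.Dom h (fun s c => N.constMap c),
      { toFun := fun s => limMk _ _ _ _ _ s
        map_rel := fun R x H => (limStructure_relMap _ _ _ _ _ R x).2
          (Filter.Eventually.of_forall fun i => ⟨_, fun _ => rfl, (g i).map_rel _ _ H⟩)
        map_const := fun c => rfl }, ?_, fun s => limMk_surjective _ _ _ _ _ s, fun p => ?_⟩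
    · refine limStructure_localModel l B N.Dom h _ hB
        (fun s c => Filter.Eventually.of_forall fun i => congrArg some ((g i).map_const c))
        (fun s y y' => ?_)
      obtain ⟨d, hd⟩ := hN.1.total y y'
      exact ⟨d, Filter.Eventually.of_forall fun i => ⟨_, _, rfl, rfl, (g i).map_locRel hd⟩⟩
    · refine (limMk_eq _ _ _ _ _).trans (Filter.eventually_congr
        (Filter.Eventually.of_forall fun i => ?_))
      exact (Option.some_injective _).eq_iff
  obtain ⟨k, hk⟩ := zorn_subset K (by
    intro c hcK hc
    have hex : ∀ k : c, ∃ (N' : LStructure L) (g : LHom N N'), LocalModel N' T ∧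
        (k : Set _) = ker N' g := fun k => by
      obtain ⟨N', g, h1, -, h2⟩ := hcK k.2
      exact ⟨N', g, h1, h2⟩
    choose B g hB hk using hex
    rcases c.eq_empty_or_nonempty with rfl | hne
    · obtain ⟨N', g', h1, h2, -⟩ := limit (pure () : Filter Unit) (fun _ => N)
        (fun _ => LHom.id N) (fun _ => hN)
      exact ⟨_, ⟨N', g', h1, h2, rfl⟩, by simp⟩
    · have : Nonempty c := hne.to_subtype
      have : IsDirectedOrder c := ⟨fun a b => by
        rcases hc.total a.2 b.2 with h | h
        · exact ⟨b, h, le_refl b⟩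
        · exact ⟨a, le_refl a, h⟩⟩
      obtain ⟨N', g', h1, h2, h3⟩ := limit (Filter.atTop : Filter c) B g hB
      refine ⟨_, ⟨N', g', h1, h2, rfl⟩, fun k hkc p hp => (h3 p).2 ?_⟩
      refine (Filter.eventually_ge_atTop (⟨k, hkc⟩ : c)).mono fun j hj => ?_
      rw [← hk j]
      exact hj hp)
  obtain ⟨N₁, g₁, hN₁, hsurj, rfl⟩ := hk.prop
  refine ⟨N₁, g₁, hN₁, isSeparated_of_injective hN₁ fun N' g hN' s a b hab => ?_⟩
  obtain ⟨a, rfl⟩ := hsurj s a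
  obtain ⟨b, rfl⟩ := hsurj s b
  obtain ⟨N₂, g₂, h1, h2, h3⟩ := limit (pure () : Filter Unit) (fun _ => N')
    (fun _ => g.comp g₁) (fun _ => hN')
  have h3' : ∀ p, p ∈ ker N₂ g₂ ↔ p ∈ ker N' (g.comp g₁) := fun p => by
    rw [h3 p, Filter.eventually_pure]
  have hle : ker N₁ g₁ ≤ ker N₂ g₂ := fun p hp => (h3' p).2 (congrArg (g.toFun p.1) hp)
  exact hk.le_of_ge ⟨N₂, g₂, h1, h2, rfl⟩ hle
    ((h3' ⟨s, a, b⟩).2 hab : (⟨s, a, b⟩ : Σ s, N.Dom s × N.Dom s) ∈ ker N₂ g₂)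

/-! ### Retractors from a bound on separated models -/

theorem exists_extend_injective {A B Z : Type} [Infinite Z] (f : A → B)
    (hf : Function.Injective f) (ι : A → Set Z) (hι : Function.Injective ι)
    (hA : Nonempty (A ↪ Z)) (hB : Nonempty (B ↪ Z)) :
    ∃ ι' : B → Set Z, Function.Injective ι' ∧ ∀ a, ι' (f a) = ι a := by
  have hlt : Cardinal.mk Z < Cardinal.mk (Set Z) := by
    rw [Cardinal.mk_set]
    exact Cardinal.cantor _
  have hA' : Cardinal.mk A ≤ Cardinal.mk Z := hA
  have hB' : Cardinal.mk B ≤ Cardinal.mk Z := hB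
  have hcompl : Cardinal.mk ((Set.range ι)ᶜ : Set (Set Z)) = Cardinal.mk (Set Z) :=
    Cardinal.mk_compl_of_infinite _ ((Cardinal.mk_range_eq ι hι).trans_lt (hA'.trans_lt hlt))
  have hle : Cardinal.mk B ≤ Cardinal.mk ((Set.range ι)ᶜ : Set (Set Z)) :=
    hcompl ▸ hB'.trans hlt.le
  obtain ⟨e⟩ := hle
  refine ⟨Function.extend f ι (fun b => (e b).1), ?_, hf.extend_apply _ _⟩
  intro x y hxy
  by_cases hx : ∃ a, f a = x <;> by_cases hy : ∃ a, f a = y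
  · obtain ⟨a, rfl⟩ := hx
    obtain ⟨b, rfl⟩ := hy
    rw [hf.extend_apply, hf.extend_apply] at hxy
    rw [hι hxy]
  · obtain ⟨a, rfl⟩ := hx
    rw [hf.extend_apply, Function.extend_apply' _ _ _ hy] at hxy
    exact absurd ⟨a, hxy⟩ (e y).2
  · obtain ⟨b, rfl⟩ := hy
    rw [hf.extend_apply, Function.extend_apply' _ _ _ hx] at hxy
    exact absurd ⟨b, hxy.symm⟩ (e x).2
  · rw [Function.extend_apply' _ _ _ hx, Function.extend_apply' _ _ _ hy] at hxy
    exact e.injective (Subtype.ext hxy)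

/-- A separated local model whose elements are named by elements of `X`. -/
structure NamedModel {L : LocalLanguage} (T : Set (PosSentence L)) (X : Type) where
  M : LStructure L
  model : LocalModel M T
  separated : IsSeparated T M
  name : ∀ s, M.Dom s → X
  name_injective : ∀ s, Function.Injective (name s)

instance {L : LocalLanguage} (T : Set (PosSentence L)) (X : Type) :
    Preorder (NamedModel T X) where
  le P Q := ∃ f : LHom P.M Q.M, ∀ s x, Q.name s (f.toFun s x) = P.name s x
  le_refl P := ⟨LHom.id P.M, fun _ _ => rfl⟩
  le_trans P Q R := fun ⟨f, hf⟩ ⟨g, hg⟩ =>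
    ⟨g.comp f, fun s x => (hg s (f.toFun s x)).trans (hf s x)⟩

theorem NamedModel.bddAbove_of_isChain {L : LocalLanguage} {T : Set (PosSentence L)} {X : Type}
    {c : Set (NamedModel T X)} (hc : IsChain (· ≤ ·) c) (hne : c.Nonempty) : BddAbove c := by
  classical
  have : Nonempty c := hne.to_subtype
  have : IsDirectedOrder c := ⟨fun a b => by
    rcases hc.total a.2 b.2 with h | h
    · exact ⟨b, h, le_refl b⟩
    · exact ⟨a, le_refl a, h⟩⟩
  let B : c → LStructure L := fun i => i.1.M
  let Y : L.Sorts → Type := fun s => {x : X // ∃ (i : c) (m : (B i).Dom s), i.1.name s m = x}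
  let h : ∀ (i : c) s, Y s → Option ((B i).Dom s) := fun i s y =>
    if H : ∃ m, i.1.name s m = y.1 then some H.choose else none
  have h_some : ∀ {i : c} {s} {y : Y s} {m : (B i).Dom s},
      h i s y = some m ↔ i.1.name s m = y.1 := by
    intro i s y m
    constructor
    · intro e
      by_cases H : ∃ m, i.1.name s m = y.1
      · simp only [h, dif_pos H, Option.some.injEq] at e
        rw [← e]
        exact H.choose_spec
      · simp [h, dif_neg H] at e
    · intro e
      have H : ∃ m, i.1.name s m = y.1 := ⟨m, e⟩
      simp only [h, dif_pos H, Option.some.injEq]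
      exact i.1.name_injective s (H.choose_spec.trans e.symm)
  let nm : ∀ (i : c) s, (B i).Dom s → Y s := fun i s m => ⟨i.1.name s m, i, m, rfl⟩
  have hnm : ∀ s (y : Y s), ∃ i : c, ∃ m, nm i s m = y := by
    rintro s ⟨x, i, m, rfl⟩
    exact ⟨i, m, rfl⟩
  have hcommon : ∀ s (y y' : Y s), ∃ i : c, ∃ m m', nm i s m = y ∧ nm i s m' = y' := by
    intro s y y'
    obtain ⟨i, m, hm⟩ := hnm s y
    obtain ⟨j, m', hm'⟩ := hnm s y'
    obtain ⟨k, ⟨f, hf⟩, ⟨g, hg⟩⟩ := exists_ge_ge i j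
    refine ⟨k, f.toFun s m, g.toFun s m', ?_, ?_⟩
    · rw [← hm]
      exact Subtype.ext (hf s m)
    · rw [← hm']
      exact Subtype.ext (hg s m')
  have hev : ∀ i : c, ∀ᶠ j in Filter.atTop, ∃ f : LHom (B i) (B j),
      ∀ s m, h j s (nm i s m) = some (f.toFun s m) := fun i =>
    (Filter.eventually_ge_atTop i).mono fun j ⟨f, hf⟩ =>
      ⟨f, fun s m => h_some.2 (hf s m)⟩
  obtain ⟨i₀⟩ := ‹Nonempty c›
  let cst : ∀ s, L.Const s → Y s := fun s a => nm i₀ s ((B i₀).constMap a)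
  have hcst : ∀ s (a : L.Const s), ∀ᶠ i in Filter.atTop,
      h i s (cst s a) = some ((B i).constMap a) := fun s a =>
    (hev i₀).mono fun j ⟨f, hf⟩ => (hf _ _).trans (congrArg some (f.map_const a))
  have htot : ∀ s (y y' : Y s), ∃ d : L.Loc s, ∀ᶠ i in Filter.atTop,
      ∃ z z', h i s y = some z ∧ h i s y' = some z' ∧ (B i).locRel d z z' := by
    intro s y y'
    obtain ⟨i, m, m', rfl, rfl⟩ := hcommon s y y'
    obtain ⟨d, hd⟩ := i.1.model.1.total m m'
    exact ⟨d, (hev i).mono fun j ⟨f, hf⟩ => ⟨_, _, hf _ _, hf _ _, f.map_locRel hd⟩⟩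
  let N := limStructure Filter.atTop B Y h cst
  let mk : ∀ s, Y s → N.Dom s := limMk Filter.atTop B Y h cst
  have hmk : ∀ {s} {y y' : Y s}, mk s y = mk s y' → y = y' := by
    intro s y y' e
    obtain ⟨d, hd⟩ := htot s y y'
    obtain ⟨i, h1, z, z', h2, h3, -⟩ := (((limMk_eq _ _ _ _ _).1 e).and hd).exists
    refine Subtype.ext ?_
    rw [← h_some.1 h2, ← h_some.1 h3]
    rw [h2, h3] at h1
    rw [Option.some_injective _ h1]
  have hmks : ∀ s, Function.Surjective (mk s) := limMk_surjective _ _ _ _ _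
  let inc : ∀ i : c, LHom (B i) N := fun i =>
    { toFun := fun s m => mk s (nm i s m)
      map_rel := fun R x H => (limStructure_relMap _ _ _ _ _ R (fun j => nm i _ (x j))).2
        ((hev i).mono fun j ⟨f, hf⟩ => ⟨_, fun k => hf _ _, f.map_rel _ _ H⟩)
      map_const := fun a => (limMk_eq _ _ _ _ _).2 (((hev i).and (hcst _ a)).mono
        fun j ⟨⟨f, hf⟩, h2⟩ => ((hf _ _).trans (congrArg some (f.map_const a))).trans h2.symm) }
  have hinv : ∀ s y, Function.surjInv (hmks s) (mk s y) = y := fun s y =>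
    hmk (Function.surjInv_eq (hmks s) _)
  refine ⟨⟨N, limStructure_localModel _ B Y h cst (fun i => i.1.model) hcst htot, ?_,
    fun s x => (Function.surjInv (hmks s) x).1, ?_⟩, ?_⟩
  · intro s a b hab
    obtain ⟨y, rfl⟩ := hmks s a
    obtain ⟨y', rfl⟩ := hmks s b
    obtain ⟨i, m, m', rfl, rfl⟩ := hcommon s y y'
    obtain ⟨F, hF⟩ := i.1.separated s m m' (fun e => hab (by rw [e]))
    refine ⟨F.image (DFact.map (inc i)), fun C k hC hk z => ?_⟩
    exact hF C (fun s x => k s ((inc i).toFun s x)) hC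
      (fun f hf => DFact.Holds.of_map (hk _ (Finset.mem_image_of_mem _ hf))) z
  · intro s a b hab
    exact Function.injective_surjInv (hmks s) (Subtype.ext hab)
  · intro P hP
    refine ⟨inc ⟨P, hP⟩, fun s x => ?_⟩
    exact congrArg Subtype.val (hinv s (nm ⟨P, hP⟩ s x))

theorem exists_isRetractor {L : LocalLanguage} {T : Set (PosSentence L)} (hsat : LocSat T)
    (Z : Type) [Infinite Z] (hZ : ∀ N : LStructure L, LocalModel N T → IsSeparated T N →
      ∀ s, Nonempty (N.Dom s ↪ Z)) : ∃ C : LStructure L, IsRetractor T C := by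
  have : Nonempty (NamedModel T (Set Z)) := by
    obtain ⟨M, hM⟩ := hsat
    obtain ⟨N, -, hN, hsep⟩ := exists_separated hM
    have e : ∀ s, N.Dom s ↪ Z := fun s => (hZ N hN hsep s).some
    exact ⟨⟨N, hN, hsep, fun s x => {e s x},
      fun s => Set.singleton_injective.comp (e s).injective⟩⟩
  obtain ⟨P, hP⟩ := zorn_le_nonempty (α := NamedModel T (Set Z))
    fun c hc hne => NamedModel.bddAbove_of_isChain hc hne
  refine ⟨P.M, P.model, fun N hN f => ?_⟩
  obtain ⟨N₁, g, hN₁, hsep⟩ := exists_separated hN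
  have hinj := P.separated.injective hN₁ (g.comp f)
  choose ι hι hι' using fun s => exists_extend_injective _ (hinj s) (P.name s)
    (P.name_injective s) (hZ _ P.model P.separated s) (hZ _ hN₁ hsep s)
  obtain ⟨r, hr⟩ := hP (b := ⟨N₁, hN₁, hsep, ι, hι⟩) ⟨g.comp f, hι'⟩
  refine ⟨r.comp g, LHom.ext fun s x => P.name_injective s ?_⟩
  exact (hr s _).trans (hι' s x)

/-! ### A bound on the size of sets covered by relations without large cliques -/

/-- The index set of the sequences naming the elements of a set covered by relations indexed by
`Φ`. -/
abbrev CliqueIndex (Φ : Type) : Type :=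
  (Order.succ (Cardinal.mk (Φ ⊕ ℕ))).ord.ToType

instance (Φ : Type) : Infinite (CliqueIndex Φ) := by
  rw [Cardinal.infinite_iff, Cardinal.mk_toType, Cardinal.card_ord]
  exact (Cardinal.aleph0_le_mk (Φ ⊕ ℕ)).trans (Order.le_succ _)

theorem nonempty_embedding_of_no_clique {A Φ : Type} (Q : Φ → A → A → Prop)
    (hQ : ∀ a b, a ≠ b → ∃ ψ, Q ψ a b)
    (hclique : ∀ ψ, ∃ k : ℕ, ¬ ∃ a : Fin k → A,
      ∀ i j, i ≠ j → Q ψ (a i) (a j) ∨ Q ψ (a j) (a i)) :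
    Nonempty (A ↪ (CliqueIndex Φ → Option Φ)) := by
  classical
  rcases isEmpty_or_nonempty A with hA | hA
  · exact ⟨Function.Embedding.ofIsEmpty⟩
  choose ψ hψ using hQ
  let col : A → A → Option Φ := fun a b => if h : a = b then none else some (ψ a b h)
  have hcol : ∀ {a b p}, col a b = some p → Q p a b := by
    intro a b p h
    by_cases hab : a = b
    · simp [col, hab] at h
    · simp only [col, dif_neg hab, Option.some.injEq] at h
      exact h ▸ hψ a b hab
  have hnone : ∀ {a b}, col a b = none ↔ a = b := by
    intro a b
    by_cases hab : a = b <;> simp [col, hab]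
  let g : A → CliqueIndex Φ → A := fun b => wellFounded_lt.fix fun w ih =>
    Classical.epsilon fun a => ∀ (w' : CliqueIndex Φ) (hw : w' < w),
      col (ih w' hw) a = col (ih w' hw) b
  have hg : ∀ b w, g b w =
      Classical.epsilon fun a => ∀ w' < w, col (g b w') a = col (g b w') b := fun b w =>
    WellFounded.fix_eq _ _ _
  have hspec : ∀ b w, ∀ w' < w, col (g b w') (g b w) = col (g b w') b := by
    intro b w
    rw [hg b w]
    exact Classical.epsilon_spec (p := fun a => ∀ w' < w, col (g b w') a = col (g b w') b)
      ⟨b, fun _ _ => rfl⟩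
  have hreach : ∀ b, ∃ w, g b w = b := by
    intro b
    by_contra! hne
    have hsome : ∀ w, ∃ p, col (g b w) b = some p := fun w =>
      Option.ne_none_iff_exists'.1 fun h => hne w (hnone.1 h)
    choose p hp using hsome
    obtain ⟨q, hq⟩ := Cardinal.exists_infinite_fiber
      (fun w => (Sum.inl (p w) : Φ ⊕ ℕ)) (by
        rw [Cardinal.mk_toType, Cardinal.card_ord]
        exact Order.lt_succ _)
    obtain ⟨⟨w₀, hw₀⟩⟩ := hq.nonempty
    obtain rfl : Sum.inl (p w₀) = q := hw₀
    obtain ⟨k, hk⟩ := hclique (p w₀)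
    let e := (Infinite.natEmbedding
      ((fun w => (Sum.inl (p w) : Φ ⊕ ℕ)) ⁻¹' {Sum.inl (p w₀)}))
    have hlt : ∀ i j : ℕ, (e i).1 < (e j).1 → Q (p w₀) (g b (e i).1) (g b (e j).1) := by
      intro i j hij
      refine hcol ?_
      rw [hspec b _ _ hij, hp]
      exact congrArg some (Sum.inl_injective (e i).2)
    refine hk ⟨fun i => g b (e i).1, fun i j hij => ?_⟩
    have hne : (e i).1 ≠ (e j).1 := fun h => hij (Fin.ext (e.injective (Subtype.ext h)))
    exact (lt_or_gt_of_ne hne).imp (hlt _ _) (hlt _ _)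
  refine ⟨⟨fun b w => col (g b w) b, fun b b' h => ?_⟩⟩
  have h' : ∀ w, col (g b w) b = col (g b' w) b' := fun w => congrFun h w
  have hgg : ∀ w, g b w = g b' w := by
    refine fun w => wellFounded_lt.induction (C := fun w => g b w = g b' w) w fun w ih => ?_
    rw [hg b w, hg b' w]
    congr 1
    funext a
    refine propext (forall₂_congr fun w' hw => ?_)
    rw [h' w', ih w' hw]
  obtain ⟨w, hw⟩ := hreach b
  have := h' w
  rw [hw, hnone.2 rfl, eq_comm, hnone, ← hgg, hw] at this
  exact this

/-! ### One-sorted translation and elementary substructures -/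

/-- The one-sorted first-order language of a many-sorted local language. -/
def LocalLanguage.oneSorted (L : LocalLanguage) : FirstOrder.Language where
  Functions n := {_c : Σ s, L.Const s // n = 0}
  Relations n := Σ ρ : Fin n → L.Sorts, L.Rel n ρ

theorem LocalLanguage.aleph0_le_card (L : LocalLanguage) : Cardinal.aleph0 ≤ L.card :=
  le_max_left _ _

theorem LocalLanguage.card_oneSorted_le (L : LocalLanguage) : L.oneSorted.card ≤ L.card := by
  refine le_trans ?_ (le_max_right _ _)
  refine Cardinal.mk_le_of_injective (f := fun x : L.oneSorted.Symbols => match x with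
    | .inl ⟨_, f⟩ => .inr (.inl f.1)
    | .inr ⟨n, r⟩ => .inr (.inr (.inr ⟨n, r.1, r.2⟩))) ?_
  rintro (⟨n, f, rfl⟩ | ⟨n, ρ, R⟩) (⟨m, g, rfl⟩ | ⟨m, τ, S⟩) h
  · cases h
    rfl
  · cases h
  · cases h
  · cases h
    rfl

theorem LocalLanguage.card_sorts_le (L : LocalLanguage) : Cardinal.mk L.Sorts ≤ L.card :=
  le_trans (Cardinal.mk_le_of_injective Sum.inl_injective) (le_max_right _ _)

theorem LocalLanguage.card_loc_le (L : LocalLanguage) :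
    Cardinal.mk (Σ s, L.Loc s) ≤ L.card :=
  le_trans (Cardinal.mk_le_of_injective
    (Sum.inr_injective.comp (Sum.inr_injective.comp Sum.inl_injective))) (le_max_right _ _)

theorem LocalLanguage.card_formula_le (L : LocalLanguage) (α : Type)
    (hα : Cardinal.mk α ≤ L.card) : Cardinal.mk (L.oneSorted.Formula α) ≤ L.card := by
  refine (Cardinal.mk_le_of_injective (f := fun φ =>
    (⟨0, φ⟩ : Σ n, L.oneSorted.BoundedFormula α n)) sigma_mk_injective).trans ?_
  refine FirstOrder.Language.BoundedFormula.card_le.trans ?_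
  simp only [Cardinal.lift_id]
  exact max_le L.aleph0_le_card
    (Cardinal.add_le_of_le L.aleph0_le_card hα L.card_oneSorted_le)

/-- The elements of a structure of all sorts. -/
def LStructure.Pt {L : LocalLanguage} (M : LStructure L) : Type :=
  Σ s, M.Dom s

/-- An element of a given sort. -/
def LStructure.pt {L : LocalLanguage} (M : LStructure L) (s : L.Sorts) (x : M.Dom s) : M.Pt :=
  ⟨s, x⟩

theorem LStructure.pt_injective {L : LocalLanguage} (M : LStructure L) (s : L.Sorts) :
    Function.Injective (M.pt s) :=
  sigma_mk_injective

instance {L : LocalLanguage} (M : LStructure L) : L.oneSorted.Structure M.Pt where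
  funMap f _ := M.pt f.1.1 (M.constMap f.1.2)
  RelMap r x := ∃ y : ∀ i, M.Dom (r.1 i), (∀ i, x i = M.pt (r.1 i) (y i)) ∧ M.relMap r.2 y

/-- The one-sorted function symbol of a constant. -/
def LocalLanguage.constSym {L : LocalLanguage} {s : L.Sorts} (c : L.Const s) :
    L.oneSorted.Functions 0 :=
  (⟨⟨s, c⟩, rfl⟩ : {_c : Σ s, L.Const s // 0 = 0})

/-- The one-sorted relation symbol of a relation. -/
def LocalLanguage.relSym {L : LocalLanguage} {n : ℕ} {ρ : Fin n → L.Sorts} (R : L.Rel n ρ) :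
    L.oneSorted.Relations n :=
  (⟨ρ, R⟩ : Σ ρ : Fin n → L.Sorts, L.Rel n ρ)

/-- Translation of terms. -/
def LTerm.toFO {L : LocalLanguage} {α : Type} {σ : α → L.Sorts} :
    {s : L.Sorts} → LTerm L α σ s → L.oneSorted.Term α
  | _, .var a => .var a
  | _, .const c => .func (LocalLanguage.constSym c) Fin.elim0

theorem LTerm.realize_toFO {L : LocalLanguage} {M : LStructure L} {α : Type} {σ : α → L.Sorts}
    {s : L.Sorts} (t : LTerm L α σ s) (v : ∀ a, M.Dom (σ a)) :
    t.toFO.realize (fun a => M.pt (σ a) (v a)) = M.pt s (t.realize M v) := by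
  cases t <;> rfl

/-- The formula expressing that a relation symbol holds of terms. -/
def relToFO {L : LocalLanguage} {α : Type} {n : ℕ} {ρ : Fin n → L.Sorts} (R : L.Rel n ρ)
    (ts : Fin n → L.oneSorted.Term α) : L.oneSorted.Formula α :=
  (LocalLanguage.relSym R).formula ts

theorem realize_relToFO {L : LocalLanguage} {M : LStructure L} {α : Type} {n : ℕ}
    {ρ : Fin n → L.Sorts} (R : L.Rel n ρ) (ts : Fin n → L.oneSorted.Term α) (v : α → M.Pt) :
    (relToFO R ts).Realize v ↔
      ∃ y : ∀ i, M.Dom (ρ i), (∀ i, (ts i).realize v = M.pt (ρ i) (y i)) ∧ M.relMap R y := by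
  unfold relToFO
  rw [FirstOrder.Language.Formula.realize_rel]
  rfl

/-- Translation of positive formulas. -/
def PosForm.toFO {L : LocalLanguage} : {α : Type} → {σ : α → L.Sorts} → PosForm L α σ →
    L.oneSorted.Formula α
  | _, _, .rel R ts => relToFO R fun i => (ts i).toFO
  | _, _, .and φ ψ => φ.toFO ⊓ ψ.toFO
  | _, _, .or φ ψ => φ.toFO ⊔ ψ.toFO
  | α, _, .ex s φ => FirstOrder.Language.Formula.iExs (β := Unit)
      (φ.toFO.relabel (fun o : Option α => o.elim (.inr ()) .inl) ⊓
        relToFO (L.locToRel (L.dd0 s)) fun _ => .var (.inr ()))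

theorem realize_dd0 {L : LocalLanguage} {M : LStructure L} (hM : IsLocal M) {α : Type}
    (s : L.Sorts) (t : L.oneSorted.Term α) (v : α → M.Pt) :
    (relToFO (L.locToRel (L.dd0 s)) fun _ => t).Realize v ↔
      ∃ x : M.Dom s, t.realize v = M.pt s x := by
  rw [realize_relToFO]
  constructor
  · rintro ⟨y, hy, -⟩
    exact ⟨y 0, hy 0⟩
  · rintro ⟨x, hx⟩
    refine ⟨dpair (C := fun i => M.Dom (![s, s] i)) x x, fun i => ?_, hM.refl _ x⟩
    match i with
    | ⟨0, _⟩ => exact hx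
    | ⟨1, _⟩ => exact hx

theorem pt_vcons {L : LocalLanguage} {M : LStructure L} {α : Type} {σ : α → L.Sorts}
    {s : L.Sorts} (x : M.Dom s) (v : ∀ a, M.Dom (σ a)) (i : Unit → M.Pt) (hi : i () = M.pt s x) :
    Sum.elim (fun a => M.pt (σ a) (v a)) i ∘
        (fun o : Option α => o.elim (.inr ()) .inl) =
      fun o => M.pt (osort s σ o) (vcons x v o) := by
  funext o
  cases o with
  | none => exact hi
  | some a => rfl

theorem PosForm.realize_toFO {L : LocalLanguage} {M : LStructure L} (hM : IsLocal M) {α : Type}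
    {σ : α → L.Sorts} (φ : PosForm L α σ) : ∀ v : ∀ a, M.Dom (σ a),
      φ.toFO.Realize (fun a => M.pt (σ a) (v a)) ↔ φ.Realize M v := by
  induction φ with
  | @rel α σ n ρ R ts =>
    intro v
    rw [PosForm.toFO, realize_relToFO]
    simp only [LTerm.realize_toFO]
    constructor
    · rintro ⟨y, hy, hR⟩
      have : y = fun i => (ts i).realize M v := by
        funext i
        exact (M.pt_injective _ (hy i)).symm
      rw [this] at hR
      exact hR
    · exact fun hR => ⟨_, fun _ => rfl, hR⟩
  | and φ ψ ihφ ihψ =>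
    intro v
    rw [PosForm.toFO, FirstOrder.Language.Formula.realize_inf, ihφ, ihψ]
    rfl
  | or φ ψ ihφ ihψ =>
    intro v
    rw [PosForm.toFO, FirstOrder.Language.Formula.realize_sup, ihφ, ihψ]
    rfl
  | ex s φ ih =>
    intro v
    rw [PosForm.toFO, FirstOrder.Language.Formula.realize_iExs]
    simp only [FirstOrder.Language.Formula.realize_inf, realize_dd0 hM,
      FirstOrder.Language.Formula.realize_relabel]
    constructor
    · rintro ⟨i, h, x, hx⟩
      rw [pt_vcons x v i hx, ih] at h
      exact ⟨x, h⟩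
    · rintro ⟨x, hx⟩
      refine ⟨fun _ => M.pt s x, ?_, x, rfl⟩
      rw [pt_vcons x v _ rfl, ih]
      exact hx

/-- The inclusion of a substructure. -/
def Substruct.incl {L : LocalLanguage} {M : LStructure L} (A : Substruct M) :
    LHom A.toStruct M where
  toFun _ x := x.1
  map_rel _ _ h := h
  map_const _ := rfl

theorem Substruct.localModel {L : LocalLanguage} {T : Set (PosSentence L)} {M : LStructure L}
    (hM : LocalModel M T) (A : Substruct M) : LocalModel A.toStruct T :=
  hM.of_embedding A.incl (fun _ _ h => h) fun _ => Subtype.val_injective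

theorem exists_elementarySubstructure_card_le {L : LocalLanguage} (M : LStructure L)
    (S : Set M.Pt) (hS : Cardinal.mk S ≤ L.card) :
    ∃ E : L.oneSorted.ElementarySubstructure M.Pt, S ⊆ E ∧ Cardinal.mk E ≤ L.card := by
  rcases le_total L.card (Cardinal.mk M.Pt) with h | h
  · obtain ⟨E, hE, hcard⟩ := FirstOrder.Language.exists_elementarySubstructure_card_eq
      L.oneSorted S L.card L.aleph0_le_card (by simpa using hS)
      (by simpa using L.card_oneSorted_le) (by simpa using h)
    exact ⟨E, hE, (by simpa using hcard : Cardinal.mk E = L.card).le⟩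
  · exact ⟨⊤, fun _ _ => trivial, (Cardinal.mk_subtype_le _).trans h⟩

theorem exists_substruct_card_le {L : LocalLanguage} {M : LStructure L} (hM : IsLocal M)
    (S : Set M.Pt) (hS : Cardinal.mk S ≤ L.card) :
    ∃ A : Substruct M, (∀ s x, M.pt s x ∈ S → x ∈ A.carrier s) ∧
      A.toStruct.card ≤ L.card ∧ A.incl.IsPosEmbedding := by
  obtain ⟨E, hE, hcard⟩ := exists_elementarySubstructure_card_le M S hS
  let A : Substruct M :=
    { carrier := fun s => {x | M.pt s x ∈ E}
      const_mem := fun {s} c => E.toSubstructure.fun_mem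
        (LocalLanguage.constSym c) Fin.elim0 (fun i => i.elim0) }
  refine ⟨A, fun s x h => hE h, le_trans ?_ hcard, ?_⟩
  · refine Cardinal.mk_le_of_injective
      (f := fun p : (Σ s, A.toStruct.Dom s) => (⟨M.pt p.1 p.2.1, p.2.2⟩ : E)) ?_
    rintro ⟨s, x, hx⟩ ⟨t, y, hy⟩ h
    obtain ⟨rfl, h⟩ := Sigma.mk.inj (congrArg Subtype.val h)
    obtain rfl := eq_of_heq h
    rfl
  · intro α σ φ
    induction φ with
    | rel R ts =>
      intro v h
      simp only [PosForm.Realize, ← LHom.map_term A.incl] at h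
      exact h
    | and φ ψ ihφ ihψ => exact fun v h => ⟨ihφ v h.1, ihψ v h.2⟩
    | or φ ψ ihφ ihψ => exact fun v h => h.imp (ihφ v) (ihψ v)
    | @ex α σ s φ ih =>
      intro v h
      let v' : α → E := fun a => ⟨M.pt (σ a) (v a).1, (v a).2⟩
      have h1 : (PosForm.ex s φ).toFO.Realize (E.subtype ∘ v') :=
        (PosForm.realize_toFO hM _ _).2 h
      rw [E.subtype.map_formula, PosForm.toFO, FirstOrder.Language.Formula.realize_iExs] at h1
      obtain ⟨i, hi⟩ := h1
      rw [← E.subtype.map_formula, FirstOrder.Language.Formula.realize_inf, realize_dd0 hM,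
        FirstOrder.Language.Formula.realize_relabel] at hi
      obtain ⟨h2, x, hx⟩ := hi
      have hx' : (i ()).1 = M.pt s x := hx
      have hxA : x ∈ A.carrier s := by
        have := (i ()).2
        rw [hx'] at this
        exact this
      let xA : A.toStruct.Dom s := ⟨x, hxA⟩
      refine ⟨xA, ih _ ?_⟩
      rw [comp_vcons A.incl.toFun, ← PosForm.realize_toFO hM]
      have e : E.subtype ∘ Sum.elim v' i =
          Sum.elim (fun a => M.pt (σ a) (v a).1) (fun u => (i u).1) := by
        funext o
        rcases o with a | u <;> rfl
      rw [e, pt_vcons x (fun a => (v a).1) _ hx'] at h2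
      exact h2

/-! ### Formulas from finitely many facts -/

/-- The elements occurring in a fact. -/
def DFact.support {L : LocalLanguage} {N : LStructure L} : DFact N → Set N.Pt
  | .inl f => Set.range fun i => N.pt _ (f.2.2.2.1 i)
  | .inr c => {N.pt _ (N.constMap c.2)}

theorem DFact.finite_support {L : LocalLanguage} {N : LStructure L} (f : DFact N) :
    f.support.Finite := by
  rcases f with f | c
  · exact Set.finite_range _
  · exact Set.finite_singleton _

open Classical in
/-- The partial map taking a tuple to another tuple. -/
def tupleMap {L : LocalLanguage} {N B : LStructure L} {α : Type} {σ : α → L.Sorts}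
    (v : ∀ a, N.Dom (σ a)) (u : ∀ a, B.Dom (σ a)) (s : L.Sorts) (m : N.Dom s) :
    Option (B.Dom s) :=
  if H : ∃ z : B.Dom s, ∃ a, (⟨σ a, v a, u a⟩ : Σ s, N.Dom s × B.Dom s) = ⟨s, m, z⟩ then
    some H.choose
  else none

theorem tupleMap_apply {L : LocalLanguage} {N B : LStructure L} {α : Type} {σ : α → L.Sorts}
    {v : ∀ a, N.Dom (σ a)} (hv : Function.Injective fun a => N.pt (σ a) (v a))
    (u : ∀ a, B.Dom (σ a)) (a : α) : tupleMap v u (σ a) (v a) = some (u a) := by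
  have H : ∃ z : B.Dom (σ a), ∃ a',
      (⟨σ a', v a', u a'⟩ : Σ s, N.Dom s × B.Dom s) = ⟨σ a, v a, z⟩ := ⟨u a, a, rfl⟩
  rw [tupleMap, dif_pos H]
  obtain ⟨a', ha'⟩ := H.choose_spec
  obtain rfl : a' = a :=
    hv (congrArg (fun p : (Σ s, N.Dom s × B.Dom s) => N.pt p.1 p.2.1) ha')
  have := eq_of_heq (Sigma.mk.inj ha').2
  exact congrArg some (Prod.mk.inj this).2.symm

theorem exists_term {L : LocalLanguage} {N : LStructure L} {α : Type} {σ : α → L.Sorts}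
    {v : ∀ a, N.Dom (σ a)} (hv : Function.Injective fun a => N.pt (σ a) (v a)) {s : L.Sorts}
    {m : N.Dom s} (hm : N.pt s m ∈ Set.range fun a => N.pt (σ a) (v a)) :
    ∃ t : LTerm L α σ s, t.realize N v = m ∧
      ∀ (B : LStructure L) (u : ∀ a, B.Dom (σ a)), tupleMap v u s m = some (t.realize B u) := by
  obtain ⟨a, ha⟩ := hm
  obtain ⟨rfl, h⟩ := Sigma.mk.inj ha
  obtain rfl := eq_of_heq h
  exact ⟨.var a, rfl, fun B u => tupleMap_apply hv u a⟩

theorem exists_formula_of_fact {L : LocalLanguage} {N : LStructure L} (hN : IsLocal N)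
    {α : Type} {σ : α → L.Sorts} {v : ∀ a, N.Dom (σ a)}
    (hv : Function.Injective fun a => N.pt (σ a) (v a)) (f : DFact N)
    (hf : f.support ⊆ Set.range fun a => N.pt (σ a) (v a)) :
    ∃ φ : LPosForm L α σ, φ.Realize N v ∧ ∀ (B : LStructure L), IsLocal B →
      ∀ u : ∀ a, B.Dom (σ a), φ.Realize B u → f.Holds B (tupleMap v u) := by
  rcases f with ⟨n, ρ, R, x, H⟩ | ⟨s, c⟩
  · choose t ht ht' using fun i => exists_term hv (hf ⟨i, rfl⟩)
    refine ⟨.rel R t, ?_, fun B _ u h => ⟨_, fun i => ht' i B u, h⟩⟩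
    simp only [LPosForm.Realize, ht]
    exact H
  · obtain ⟨t, ht, ht'⟩ := exists_term hv (hf rfl)
    refine ⟨.rel (L.locToRel (L.dd0 s)) (tpair t (.const c)), ?_, fun B hB u h => ?_⟩
    · rw [realize_rel_tpair, hN.dd0_eq]
      exact ht
    · rw [realize_rel_tpair, hB.dd0_eq] at h
      exact (ht' B u).trans (congrArg some h)

theorem exists_formula_of_facts_of_subset {L : LocalLanguage} {N : LStructure L}
    (hN : IsLocal N) {α : Type} {σ : α → L.Sorts} {v : ∀ a, N.Dom (σ a)}
    (hv : Function.Injective fun a => N.pt (σ a) (v a)) (x₀ : α) (F : List (DFact N))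
    (hF : ∀ f ∈ F, f.support ⊆ Set.range fun a => N.pt (σ a) (v a)) :
    ∃ φ : LPosForm L α σ, φ.Realize N v ∧ ∀ (B : LStructure L), IsLocal B →
      ∀ u : ∀ a, B.Dom (σ a), φ.Realize B u → ∀ f ∈ F, f.Holds B (tupleMap v u) := by
  induction F with
  | nil =>
    refine ⟨.rel (L.locToRel (L.dd0 _)) (tpair (.var x₀) (.var x₀)), ?_, ?_⟩
    · rw [realize_rel_tpair]
      exact hN.refl _ _
    · simp
  | cons f F ih =>
    obtain ⟨φ, h1, h2⟩ := ih fun g hg => hF g (List.mem_cons_of_mem _ hg)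
    obtain ⟨ψ, h3, h4⟩ := exists_formula_of_fact hN hv f (hF f List.mem_cons_self)
    refine ⟨.and ψ φ, ⟨h3, h1⟩, fun B hB u h => ?_⟩
    simp only [List.mem_cons, forall_eq_or_imp]
    exact ⟨h4 B hB u h.1, h2 B hB u h.2⟩

theorem exists_formula_of_facts {L : LocalLanguage} {N : LStructure L} (hN : IsLocal N)
    (F : List (DFact N)) (l : List N.Pt) : ∀ {α : Type} {σ : α → L.Sorts}
    {v : ∀ a, N.Dom (σ a)}, (Function.Injective fun a => N.pt (σ a) (v a)) → α →
    (∀ p ∈ l, ∃ a, σ a = p.1) →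
    (∀ f ∈ F, ∀ p ∈ f.support, p ∈ l ∨ p ∈ Set.range fun a => N.pt (σ a) (v a)) →
    ∃ φ : LPosForm L α σ, φ.Realize N v ∧ ∀ (B : LStructure L), IsLocal B →
      ∀ u : ∀ a, B.Dom (σ a), φ.Realize B u → ∃ h : ∀ s, N.Dom s → Option (B.Dom s),
        (∀ a, h _ (v a) = some (u a)) ∧ ∀ f ∈ F, f.Holds B h := by
  induction l with
  | nil =>
    intro α σ v hv x₀ _ hF
    obtain ⟨φ, h1, h2⟩ := exists_formula_of_facts_of_subset hN hv x₀ F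
      (fun f hf p hp => (hF f hf p hp).resolve_left List.not_mem_nil)
    exact ⟨φ, h1, fun B hB u h => ⟨tupleMap v u, tupleMap_apply hv u, h2 B hB u h⟩⟩
  | cons p l ih =>
    intro α σ v hv x₀ hl hF
    by_cases hp : p ∈ Set.range fun a => N.pt (σ a) (v a)
    · refine ih hv x₀ (fun q hq => hl q (List.mem_cons_of_mem _ hq)) fun f hf q hq => ?_
      rcases hF f hf q hq with h | h
      · rcases List.mem_cons.1 h with rfl | h
        · exact Or.inr hp
        · exact Or.inl h
      · exact Or.inr h
    · obtain ⟨a, ha⟩ := hl p List.mem_cons_self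
      obtain ⟨s, m⟩ := p
      obtain rfl : σ a = s := ha
      obtain ⟨d, hd⟩ := hN.total m (v a)
      obtain ⟨φ, h1, h2⟩ := ih (σ := osort (σ a) σ) (v := vcons m v) (by
          rintro (_ | b) (_ | c) h
          · rfl
          · exact absurd ⟨c, h.symm⟩ hp
          · exact absurd ⟨b, h⟩ hp
          · exact congrArg some (hv h)) (some x₀)
        (fun q hq => by
          obtain ⟨b, hb⟩ := hl q (List.mem_cons_of_mem _ hq)
          exact ⟨some b, hb⟩)
        (fun f hf q hq => by
          rcases hF f hf q hq with h | ⟨b, h⟩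
          · rcases List.mem_cons.1 h with rfl | h
            · exact Or.inr ⟨none, rfl⟩
            · exact Or.inl h
          · exact Or.inr ⟨some b, h⟩)
      refine ⟨.lex (σ a) d (.var a) φ, ⟨m, hd, h1⟩, fun B hB u ⟨x, _, hx⟩ => ?_⟩
      obtain ⟨h, h3, h4⟩ := h2 B hB _ hx
      exact ⟨h, fun b => h3 (some b), h4⟩

/-! ### Bounds holding on a ball -/

theorem realize_cast_var {L : LocalLanguage} {M : LStructure L} {α : Type} {σ : α → L.Sorts}
    (v : ∀ a, M.Dom (σ a)) (b : α) {s : L.Sorts} (e : s = σ b) :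
    (e.symm ▸ (LTerm.var b : LTerm L α σ (σ b)) : LTerm L α σ s).realize M v = e.symm ▸ v b := by
  subst e
  rfl

theorem exists_locRel_of_centers {L : LocalLanguage} {M : LStructure L} (hM : IsLocal M)
    {s t : L.Sorts} (e : s = t) (c : M.Dom s) (c' : M.Dom t) (d : L.Loc s) (d' : L.Loc t) :
    ∃ d₀ : L.Loc s, ∀ x x', M.locRel d x c → M.locRel d' x' c' →
      M.locRel d₀ x (e.symm ▸ x') := by
  subst e
  obtain ⟨d₁, h₁⟩ := hM.total c c'
  exact ⟨_, fun x x' h h' => hM.comp _ _ _ _ _ (hM.comp _ _ _ _ _ h h₁) (hM.symm _ _ _ h')⟩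

theorem exists_vbound {L : LocalLanguage} {M : LStructure L} (hM : IsLocal M) {α : Type}
    {σ : α → L.Sorts} (c : ∀ a, M.Dom (σ a)) (D : ∀ a, L.Loc (σ a)) :
    ∃ B : VBound L α σ, ∀ v, (∀ a, M.locRel (D a) (v a) (c a)) → B.Holds M v := by
  have h1 : ∀ a (h : Nonempty (L.Const (σ a))), ∃ d, ∀ x, M.locRel (D a) x (c a) →
      M.locRel d x (M.constMap h.some) := fun a h => by
    obtain ⟨d, hd⟩ := hM.total (c a) (M.constMap h.some)
    exact ⟨_, fun x hx => hM.comp _ _ _ _ _ hx hd⟩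
  choose d1 hd1 using h1
  choose d2 hd2 using fun a b e => exists_locRel_of_centers hM (s := σ a) (t := σ b) e
    (c a) (c b) (D a) (D b)
  refine ⟨⟨d1, fun _ h => h.some, d2⟩, fun v hv ψ hψ => ?_⟩
  rcases hψ with ⟨a, h, rfl⟩ | ⟨a, b, e, rfl⟩
  · rw [realize_rel_tpair]
    exact hd1 a h _ (hv a)
  · rw [realize_rel_tpair, realize_cast_var v b e]
    exact hd2 a b e _ _ (hv a) (hv b)

/-! ### Relations separating elements -/

/-- Indices of the relations separating the elements of a separated model. -/
abbrev LocalLanguage.ApartIndex (L : LocalLanguage) : Type :=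
  L.oneSorted.Formula (Fin 2 ⊕ L.Sorts) × Σ s, L.Loc s

theorem LocalLanguage.card_apartIndex_le (L : LocalLanguage) :
    Cardinal.mk L.ApartIndex ≤ L.card := by
  rw [Cardinal.mk_prod, Cardinal.lift_id, Cardinal.lift_id]
  refine Cardinal.mul_le_of_le L.aleph0_le_card (L.card_formula_le _ ?_) L.card_loc_le
  rw [Cardinal.mk_sum, Cardinal.lift_id, Cardinal.lift_id]
  exact Cardinal.add_le_of_le L.aleph0_le_card
    ((Cardinal.mk_le_aleph0 (α := Fin 2)).trans L.aleph0_le_card) L.card_sorts_le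

/-- Local positive formulas in two variables of sort `s` and one variable of each sort in
`γ`. -/
abbrev PairForm (L : LocalLanguage) (s : L.Sorts) (γ : Set L.Sorts) : Type 1 :=
  LPosForm L (Fin 2 ⊕ γ) (Sum.elim (fun _ => s) Subtype.val)

/-- The formula is incompatible in `T` with equality of its two distinguished variables. -/
def PairForm.IsIrreflexive {L : LocalLanguage} (T : Set (PosSentence L)) {s : L.Sorts}
    {γ : Set L.Sorts} (φ : PairForm L s γ) : Prop :=
  ∀ M : LStructure L, LocalModel M T → ∀ (a : M.Dom s) (w : ∀ t : γ, M.Dom t.1),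
    ¬ φ.Realize M (sval ![a, a] w)

/-- The formula is translated to a given one-sorted formula. -/
def PairForm.HasCode {L : LocalLanguage} {s : L.Sorts} {γ : Set L.Sorts} (φ : PairForm L s γ)
    (ψ : L.oneSorted.Formula (Fin 2 ⊕ L.Sorts)) : Prop :=
  ∃ φ' : PosForm L (Fin 2 ⊕ γ) (Sum.elim (fun _ => s) Subtype.val),
    (∀ (M : LStructure L) v, φ'.Realize M v ↔ φ.Realize M v) ∧
      φ'.toFO.relabel (Sum.map id Subtype.val) = ψ

theorem PairForm.exists_hasCode {L : LocalLanguage} {s : L.Sorts} {γ : Set L.Sorts}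
    (φ : PairForm L s γ) : ∃ ψ, φ.HasCode ψ := by
  obtain ⟨φ', h⟩ := φ.exists_posForm
  exact ⟨_, φ', h, rfl⟩

theorem PairForm.HasCode.realize_iff {L : LocalLanguage} {s : L.Sorts} {γ : Set L.Sorts}
    {φ : PairForm L s γ} {ψ : L.oneSorted.Formula (Fin 2 ⊕ L.Sorts)} (h : φ.HasCode ψ)
    {M : LStructure L} (hM : IsLocal M) (z : Fin 2 → M.Dom s) (w : ∀ t : γ, M.Dom t.1)
    (E : L.Sorts → M.Pt) (hE : ∀ t : γ, E t = M.pt t.1 (w t)) :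
    φ.Realize M (sval z w) ↔ ψ.Realize (Sum.elim (fun i => M.pt s (z i)) E) := by
  obtain ⟨φ', h1, rfl⟩ := h
  rw [← h1, ← PosForm.realize_toFO hM, FirstOrder.Language.Formula.realize_relabel]
  refine Eq.to_iff (congrArg _ ?_)
  funext x
  rcases x with i | t
  · rfl
  · exact (hE t).symm

/-- A choice of base points in all nonempty sorts. -/
abbrev BasePoints {L : LocalLanguage} (N : LStructure L) : Type :=
  ∀ t, Nonempty (N.Dom t) → N.Dom t

/-- The relation of given index, for a given choice of base points. -/
def Apart {L : LocalLanguage} (T : Set (PosSentence L)) {N : LStructure L} (e : BasePoints N)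
    {s : L.Sorts} (p : L.ApartIndex) (a b : N.Dom s) : Prop :=
  (∃ (γ : Set L.Sorts) (hγ : ∀ t : γ, Nonempty (N.Dom t.1)) (φ : PairForm L s γ), γ.Finite ∧
    φ.IsIrreflexive T ∧ φ.HasCode p.1 ∧
      φ.Realize N (sval ![a, b] fun t => e t.1 (hγ t))) ∧
  ∃ d : L.Loc s, p.2 = ⟨s, d⟩ ∧ N.locRel d a (e s ⟨a⟩) ∧ N.locRel d b (e s ⟨a⟩)

theorem Apart.irrefl {L : LocalLanguage} {T : Set (PosSentence L)} {N : LStructure L}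
    (hN : LocalModel N T) {e : BasePoints N} {s : L.Sorts} {p : L.ApartIndex} (a : N.Dom s) :
    ¬ Apart T e p a a := by
  rintro ⟨⟨γ, hγ, φ, -, h, -, h'⟩, -⟩
  exact h N hN _ _ h'

theorem exists_apart {L : LocalLanguage} {T : Set (PosSentence L)} {N : LStructure L}
    (hN : LocalModel N T) (hsep : IsSeparated T N) (e : BasePoints N) {s : L.Sorts}
    {a b : N.Dom s} (hab : a ≠ b) : ∃ p, Apart T e p a b := by
  classical
  obtain ⟨F, hF⟩ := hsep s a b hab
  have hfin : (⋃ f ∈ F, f.support).Finite :=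
    F.finite_toSet.biUnion fun f _ => f.finite_support
  let γ : Set L.Sorts := {t | t ≠ s ∧ ∃ p ∈ hfin.toFinset, p.1 = t}
  have hγ : ∀ t : γ, Nonempty (N.Dom t.1) := by
    rintro ⟨t, -, p, -, rfl⟩
    exact ⟨p.2⟩
  have hγfin : γ.Finite :=
    (hfin.toFinset.finite_toSet.image Sigma.fst).subset fun t ht => ht.2
  let v := sval (σ := fun _ : Fin 2 => s) (τ := fun t : γ => t.1) ![a, b] fun t => e t.1 (hγ t)
  have hv : Function.Injective fun x => N.pt (Sum.elim (fun _ => s) (fun t : γ => t.1) x)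
      (v x) := by
    rintro (i | t) (j | t') h
    · have h' : ![a, b] i = ![a, b] j := N.pt_injective s h
      have hinj : Function.Injective ![a, b] := by
        intro i j hij
        fin_cases i <;> fin_cases j
        · rfl
        · exact absurd hij hab
        · exact absurd hij.symm hab
        · rfl
      rw [hinj h']
    · exact absurd (congrArg Sigma.fst h).symm t'.2.1
    · exact absurd (congrArg Sigma.fst h) t.2.1
    · exact congrArg Sum.inr (Subtype.ext (congrArg Sigma.fst h))
  obtain ⟨φ, h1, h2⟩ := exists_formula_of_facts hN.1 F.toList hfin.toFinset.toList hv (Sum.inl 0)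
    (fun p hp => by
      by_cases hps : p.1 = s
      · exact ⟨.inl 0, hps.symm⟩
      · exact ⟨.inr ⟨p.1, hps, p, Finset.mem_toList.1 hp, rfl⟩, rfl⟩)
    (fun f hf p hp => Or.inl (Finset.mem_toList.2 (hfin.mem_toFinset.2
      (Set.mem_biUnion (Finset.mem_toList.1 hf) hp))))
  obtain ⟨ψ, hψ⟩ := PairForm.exists_hasCode φ
  obtain ⟨d₁, hd₁⟩ := hN.1.total a (e s ⟨a⟩)
  obtain ⟨d₂, hd₂⟩ := hN.1.total b (e s ⟨a⟩)
  refine ⟨(ψ, ⟨s, L.locMul d₁ d₂⟩), ⟨γ, hγ, φ, hγfin, ?_, hψ, h1⟩, _, rfl,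
    hN.1.comp _ _ _ _ _ hd₁ (hN.1.refl _ _), hN.1.comp _ _ _ _ _ (hN.1.refl _ _) hd₂⟩
  intro M hM x w hx
  obtain ⟨h, h3, h4⟩ := h2 M hM.1 _ hx
  exact hF M h hM (fun f hf => h4 f (Finset.mem_toList.2 hf)) x (h3 (.inl 0)) (h3 (.inl 1))

theorem Apart.transfer {L : LocalLanguage} {T : Set (PosSentence L)} {B N : LStructure L}
    {e : BasePoints N} {s : L.Sorts} {p : L.ApartIndex} (j k : LHom B N)
    (hj : j.IsPosEmbedding) (e' : ∀ t, Nonempty (N.Dom t) → B.Dom t)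
    (hej : ∀ t h, j.toFun t (e' t h) = e t h) (hek : ∀ t h, k.toFun t (e' t h) = e t h)
    {x y : B.Dom s} (h : Apart T e p (j.toFun s x) (j.toFun s y)) :
    Apart T e p (k.toFun s x) (k.toFun s y) := by
  obtain ⟨⟨γ, hγ, φ, hfin, hirr, hcode, hφ⟩, d, hd, hx, hy⟩ := h
  have hval : ∀ i : LHom B N, (∀ t h, i.toFun t (e' t h) = e t h) →
      (fun z => i.toFun _ (sval ![x, y] (fun t : γ => e' t.1 (hγ t)) z)) =
        sval (σ := fun _ => s) (τ := fun t : γ => t.1) ![i.toFun s x, i.toFun s y]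
          fun t => e t.1 (hγ t) := by
    intro i hi
    funext z
    rcases z with n | t
    · fin_cases n <;> rfl
    · exact hi _ _
  have hloc : ∀ z, N.locRel d (j.toFun s z) (e s ⟨j.toFun s x⟩) →
      N.locRel d (k.toFun s z) (e s ⟨k.toFun s x⟩) := by
    intro z hz
    rw [← hej] at hz
    rw [← hek]
    exact k.map_locRel (hj.reflect_locRel hz)
  refine ⟨⟨γ, hγ, φ, hfin, hirr, hcode, ?_⟩, d, hd, hloc x hx, hloc y hy⟩
  obtain ⟨φ', hφ'⟩ := φ.exists_posForm
  rw [← hφ', ← hval j hej] at hφ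
  rw [← hφ', ← hval k hek]
  exact (hj _ _ _ _ hφ).map k

/-- The substitution exchanging the two distinguished variables. -/
def swapTerm {L : LocalLanguage} {s : L.Sorts} {γ : Set L.Sorts} : ∀ x : Fin 2 ⊕ γ,
    LTerm L (Fin 2 ⊕ γ) (Sum.elim (fun _ => s) Subtype.val)
      (Sum.elim (fun _ => s) Subtype.val x)
  | .inl i => LTerm.var (σ := Sum.elim (fun _ => s) Subtype.val) (Sum.inl i.rev)
  | .inr t => LTerm.var (σ := Sum.elim (fun _ => s) Subtype.val) (Sum.inr t)

theorem sval_swap {L : LocalLanguage} {M : LStructure L} {s : L.Sorts} {γ : Set L.Sorts}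
    (z : Fin 2 → M.Dom s) (w : ∀ t : γ, M.Dom t.1) :
    (fun x : Fin 2 ⊕ γ => (swapTerm x).realize M (sval z w)) =
      sval (σ := fun _ => s) (τ := fun t : γ => t.1) ![z 1, z 0] w := by
  funext x
  rcases x with i | t
  · fin_cases i <;> rfl
  · rfl

theorem PairForm.exists_symmetrization {L : LocalLanguage} {s : L.Sorts} {γ : Set L.Sorts}
    (φ : PairForm L s γ) : ∃ φ' : PairForm L s γ, ∀ (M : LStructure L) (a b : M.Dom s)
      (w : ∀ t : γ, M.Dom t.1), φ'.Realize M (sval ![a, b] w) ↔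
        φ.Realize M (sval ![a, b] w) ∨ φ.Realize M (sval ![b, a] w) := by
  obtain ⟨φ', h⟩ := LPosForm.exists_subst φ swapTerm
  refine ⟨.or φ φ', fun M a b w => or_congr Iff.rfl ?_⟩
  rw [h]
  exact Eq.to_iff (congrArg _ (sval_swap ![a, b] w))

theorem exists_no_apart_clique {L : LocalLanguage} {T : Set (PosSentence L)}
    (hcompact : IsLocPosCompact T) {N : LStructure L} (hN : LocalModel N T) (e : BasePoints N)
    (s : L.Sorts) (p : L.ApartIndex) : ∃ k : ℕ, ¬ ∃ a : Fin k → N.Dom s,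
      ∀ i j, i ≠ j → Apart T e p (a i) (a j) ∨ Apart T e p (a j) (a i) := by
  classical
  by_cases hex : ∃ a b : N.Dom s, Apart T e p a b
  swap
  · refine ⟨2, fun ⟨a, ha⟩ => ?_⟩
    exact (ha 0 1 (by decide)).elim (fun h => hex ⟨_, _, h⟩) (fun h => hex ⟨_, _, h⟩)
  obtain ⟨a₀, b₀, ⟨γ, hγ, φ, hfin, hirr, hcode, -⟩, d, hd, -⟩ := hex
  let w : ∀ t : γ, N.Dom t.1 := fun t => e t.1 (hγ t)
  have key : ∀ {a b : N.Dom s}, Apart T e p a b → φ.Realize N (sval ![a, b] w) ∧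
      N.locRel d a (e s ⟨a₀⟩) ∧ N.locRel d b (e s ⟨a₀⟩) := by
    rintro a b ⟨⟨γ', hγ', φ', -, -, hcode', h⟩, d', hd', h1, h2⟩
    obtain rfl : d = d' := eq_of_heq (Sigma.mk.inj (hd.symm.trans hd')).2
    refine ⟨?_, h1, h2⟩
    let E : L.Sorts → N.Pt := fun t =>
      if h : Nonempty (N.Dom t) then N.pt t (e t h) else N.pt s a
    rw [hcode.realize_iff hN.1 _ _ E fun t => dif_pos (hγ t)]
    exact (hcode'.realize_iff hN.1 _ _ E fun t => dif_pos (hγ' t)).1 h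
  obtain ⟨φ', hφ'⟩ := φ.exists_symmetrization
  obtain ⟨B, hB⟩ := exists_vbound hN.1
    (sval (σ := fun _ : Unit => s) (τ := fun t : γ => t.1) (fun _ => e s ⟨a₀⟩) w)
    (fun x => match x with
      | .inl _ => d
      | .inr t => L.dd0 t.1)
  obtain ⟨k, -, hk⟩ := hcompact s γ hfin _ φ'
    (fun M hM a w h => hirr M hM a w (((hφ' M a a w).1 h).elim id id)) B (L.locMul d d)
  refine ⟨k, fun ⟨a, ha⟩ => hk N hN ⟨a, w, fun i j hij => ?_⟩⟩
  have hball : N.locRel d (a i) (e s ⟨a₀⟩) ∧ N.locRel d (a j) (e s ⟨a₀⟩) :=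
    (ha i j hij).elim (fun h => (key h).2) (fun h => (key h).2.symm)
  refine ⟨hB _ ?_, hN.1.comp _ _ _ _ _ hball.1 (hN.1.symm _ _ _ hball.2), ?_⟩
  · rintro (_ | t)
    · exact hball.1
    · exact hN.1.refl _ _
  · exact (hφ' N _ _ _).2 ((ha i j hij).imp (fun h => (key h).1) (fun h => (key h).1))

/-! ### Ultrahomogeneous models are retractors -/

theorem exists_maximal_clique {A : Type} (r : A → A → Prop) (P : A → Prop) (k : ℕ)
    (hr : ∀ a b, r a b → r b a)
    (hk : ¬ ∃ a : Fin k → A, ∀ i j, i ≠ j → r (a i) (a j)) :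
    ∃ K : Finset A, (∀ a ∈ K, P a) ∧ ∀ a, P a → (∀ a' ∈ K, r a' a) → a ∈ K := by
  classical
  suffices h : ∃ K : Finset A, ((∀ a ∈ K, P a) ∧ ∀ a ∈ K, ∀ a' ∈ K, a ≠ a' → r a a') ∧
      ∀ a, P a → (∀ a' ∈ K, r a' a) → a ∈ K by
    obtain ⟨K, ⟨h1, -⟩, h2⟩ := h
    exact ⟨K, h1, h2⟩
  by_contra! hext
  have hcard : ∀ n : ℕ, ∃ K : Finset A,
      ((∀ a ∈ K, P a) ∧ ∀ a ∈ K, ∀ a' ∈ K, a ≠ a' → r a a') ∧ K.card = n := by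
    intro n
    induction n with
    | zero => exact ⟨∅, by simp⟩
    | succ n ih =>
      obtain ⟨K, hK, rfl⟩ := ih
      obtain ⟨a, ha, hra, haK⟩ := hext K hK
      refine ⟨insert a K, ⟨?_, ?_⟩, Finset.card_insert_of_notMem haK⟩
      · simpa [ha] using hK.1
      · intro x hx y hy hxy
        rcases Finset.mem_insert.1 hx with rfl | hxK <;>
          rcases Finset.mem_insert.1 hy with rfl | hyK
        · exact absurd rfl hxy
        · exact hr _ _ (hra _ hyK)
        · exact hra _ hxK
        · exact hK.2 _ hxK _ hyK hxy
  obtain ⟨K, hK, hc⟩ := hcard k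
  refine hk ⟨fun i => (K.equivFinOfCardEq hc).symm i, fun i j hij => ?_⟩
  exact hK.2 _ (Subtype.property _) _ (Subtype.property _) fun h =>
    hij ((K.equivFinOfCardEq hc).symm.injective (Subtype.ext h))

theorem LHom.surjective_of_isUltrahomogeneous {L : LocalLanguage} {T : Set (PosSentence L)}
    (hcompact : IsLocPosCompact T) {M N : LStructure L} (hM : IsPC M T)
    (hhom : IsUltrahomogeneous T M (Order.succ L.card)) (hN : LocalModel N T)
    (hsep : IsSeparated T N) (f : LHom M N) (s : L.Sorts) :
    Function.Surjective (f.toFun s) := by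
  by_contra hsurj
  have hf := hM.2 N f hN
  obtain ⟨b, hb⟩ := not_forall.1 hsurj
  let m : ∀ t, Nonempty (N.Dom t) → M.Dom t := fun t h => (hf.nonempty hN.1 h).some
  let e : BasePoints N := fun t h => f.toFun t (m t h)
  have hclique : ∀ p : L.ApartIndex, ∃ K : Finset (M.Dom s),
      (∀ a ∈ K, Apart T e p (f.toFun s a) b) ∧
        ∀ a, Apart T e p (f.toFun s a) b →
          (∀ a' ∈ K, Apart T e p (f.toFun s a') (f.toFun s a) ∨
            Apart T e p (f.toFun s a) (f.toFun s a')) → a ∈ K := by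
    intro p
    obtain ⟨k, hk⟩ := exists_no_apart_clique hcompact hN e s p
    exact exists_maximal_clique _ _ k (fun _ _ h => h.symm)
      fun ⟨a, ha⟩ => hk ⟨fun i => f.toFun s (a i), ha⟩
  choose K hKb hKmax using hclique
  obtain ⟨A, hA, hAcard, hAincl⟩ := exists_substruct_card_le hM.1.1
    (Set.range (Sum.elim (fun t : {t // Nonempty (N.Dom t)} => M.pt t.1 (m t.1 t.2))
      fun q : Σ p, K p => M.pt s q.2.1)) (by
      refine Cardinal.mk_range_le.trans ?_
      rw [Cardinal.mk_sum, Cardinal.lift_id, Cardinal.lift_id, Cardinal.mk_sigma]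
      refine Cardinal.add_le_of_le L.aleph0_le_card
        ((Cardinal.mk_subtype_le _).trans L.card_sorts_le) ?_
      refine (Cardinal.sum_le_sum _ (fun _ => Cardinal.aleph0)
        fun p => Cardinal.mk_le_aleph0).trans ?_
      rw [Cardinal.sum_const']
      exact Cardinal.mul_le_of_le L.aleph0_le_card L.card_apartIndex_le L.aleph0_le_card)
  obtain ⟨B, hB, hBcard, hBincl⟩ := exists_substruct_card_le hN.1
    (Set.range fun q : Option (Σ t, A.toStruct.Dom t) =>
      q.elim (N.pt s b) fun x => N.pt x.1 (f.toFun x.1 x.2.1)) (by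
      refine Cardinal.mk_range_le.trans ?_
      rw [Cardinal.mk_option]
      exact Cardinal.add_le_of_le L.aleph0_le_card hAcard
        (Cardinal.one_le_aleph0.trans L.aleph0_le_card))
  let g : LHom A.toStruct B.toStruct :=
    { toFun := fun t x => ⟨f.toFun t x.1, hB t _ ⟨some ⟨t, x⟩, rfl⟩⟩
      map_rel := fun R x h => f.map_rel R _ h
      map_const := fun c => Subtype.ext (f.map_const c) }
  let b' : B.toStruct.Dom s := ⟨b, hB s b ⟨none, rfl⟩⟩
  obtain ⟨h, hhg⟩ := hhom A.toStruct B.toStruct (A.localModel hM.1) (B.localModel hN)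
    (Order.lt_succ_of_le hAcard) (Order.lt_succ_of_le hBcard) A.incl hAincl g
  have hhg' : ∀ t (x : A.toStruct.Dom t), h.toFun t (g.toFun t x) = x.1 := fun t x =>
    congrFun (congrFun (congrArg LHom.toFun hhg) t) x
  let mA : ∀ t, Nonempty (N.Dom t) → A.toStruct.Dom t := fun t ht =>
    ⟨m t ht, hA t _ ⟨.inl ⟨t, ht⟩, rfl⟩⟩
  obtain ⟨p, hp⟩ := exists_apart hN hsep e (fun h' => hb ⟨h.toFun s b', h'⟩)
  have hmem : h.toFun s b' ∈ K p := by
    refine hKmax p _ hp fun a ha => Or.inl ?_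
    let aA : A.toStruct.Dom s := ⟨a, hA s a ⟨.inr ⟨p, a, ha⟩, rfl⟩⟩
    have := Apart.transfer (x := g.toFun s aA) (y := b') B.incl (f.comp h) hBincl
      (fun t ht => g.toFun t (mA t ht)) (fun _ _ => rfl)
      (fun t ht => congrArg (f.toFun t) (hhg' t (mA t ht))) (hKb p a ha)
    rwa [show (f.comp h).toFun s (g.toFun s aA) = f.toFun s a from
      congrArg (f.toFun s) (hhg' s aA)] at this
  have := Apart.transfer (x := g.toFun s ⟨h.toFun s b', hA s _ ⟨.inr ⟨p, _, hmem⟩, rfl⟩⟩)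
    (y := b') B.incl (f.comp h) hBincl
    (fun t ht => g.toFun t (mA t ht)) (fun _ _ => rfl)
    (fun t ht => congrArg (f.toFun t) (hhg' t (mA t ht))) hp
  rw [show (f.comp h).toFun s (g.toFun s ⟨h.toFun s b', _⟩) = f.toFun s (h.toFun s b') from
    congrArg (f.toFun s) (hhg' s _)] at this
  exact Apart.irrefl hN _ this

theorem LHom.IsPosEmbedding.exists_retraction {L : LocalLanguage} {M N : LStructure L}
    (hM : IsLocal M) (hN : IsLocal N) {f : LHom M N} (hf : f.IsPosEmbedding)
    (hsurj : ∀ s, Function.Surjective (f.toFun s)) : ∃ g : LHom N M, g.comp f = LHom.id M := by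
  choose g hg using hsurj
  have hgf : ∀ s x, g s (f.toFun s x) = x := fun s x => hf.injective hM hN s (hg s _)
  refine ⟨⟨g, fun R x h => hf.reflect_rel R _ ?_, fun c => ?_⟩, LHom.ext ?_⟩
  · simpa only [hg] using h
  · rw [← f.map_const c, hgf]
  · intro s x
    exact hgf s x

theorem isRetractor_of_isUltrahomogeneous {L : LocalLanguage} {T : Set (PosSentence L)}
    (hcompact : IsLocPosCompact T) {M : LStructure L} (hM : IsPC M T)
    (hhom : IsUltrahomogeneous T M (Order.succ L.card)) : IsRetractor T M := by
  refine ⟨hM.1, fun N hN f => ?_⟩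
  obtain ⟨N₁, k, hN₁, hsep⟩ := exists_separated hN
  obtain ⟨g, hg⟩ := (hM.2 N₁ (k.comp f) hN₁).exists_retraction hM.1.1 hN₁.1
    (LHom.surjective_of_isUltrahomogeneous hcompact hM hhom hN₁ hsep _)
  exact ⟨g.comp k, hg⟩

theorem exists_isRetractor_of_isLocPosCompact {L : LocalLanguage} {T : Set (PosSentence L)}
    (hsat : LocSat T) (hcompact : IsLocPosCompact T) : ∃ C, IsRetractor T C := by
  refine exists_isRetractor hsat ((CliqueIndex L.ApartIndex → Option L.ApartIndex) ⊕ ℕ)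
    fun N hN hsep s => ?_
  let e : BasePoints N := fun _ h => h.some
  obtain ⟨i⟩ := nonempty_embedding_of_no_clique (Apart T e)
    (fun _ _ hab => exists_apart hN hsep e hab) (exists_no_apart_clique hcompact hN e s)
  exact ⟨i.trans .inl⟩

/-- If `T` is local positively compact, then every
`|L|⁺`-ultrahomogeneous local positively closed model of `T` is a retractor of `T`; in
particular, `T` has retractors. -/
theorem loc_pos_compact_implies_retractors
    {L : LocalLanguage} (T : Set (PosSentence L))
    (hT : IsNegLocalTheory T) (hsat : LocSat T)
    (hcompact : IsLocPosCompact T) :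
    (∀ M : LStructure L, IsPC M T →
        IsUltrahomogeneous T M (Order.succ L.card) → IsRetractor T M) ∧
    ∃ C : LStructure L, IsRetractor T C := by
  exact ⟨fun M hM hhom => isRetractor_of_isUltrahomogeneous hcompact hM hhom,
    exists_isRetractor_of_isLocPosCompact hsat hcompact⟩
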